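/- arXiv:2605.13512 — 5 statements merged into one kernel-verified Lean document; each statement's English description precedes it below -/
import Mathlib

section
/- Let D = {(q,x,y) ∈ ℝ³ : y ≥ β(x)} and let H : D → ℝ be jointly continuous and such that for every (q,x) the map y ↦ H(q,x,y) is strictly increasing on [β(x), ∞) with lim_{y→∞} H(q,x,y) = +∞. Define g(q,x,t) := inf{ y ≥ β(x) : H(q,x,y) ≥ t }. Then g is jointly continuous as a function of (q,x,t) ∈ ℝ³. (In the paper this is applied with H(q,x,y) = Γ_c^q(x+y,y), yielding joint continuity of the level curves g^q(x,t) in (x,q,t).) -/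
/-- The lower wedge boundary `β(x) = max(0, −x)`. -/
def beta (x : ℝ) : ℝ := max 0 (-x)

/-- Joint continuity of generalised level curves: if `H` is jointly continuous on
`D = {(q,x,y) : y ≥ β(x)}`, strictly increasing in `y` on `[β(x),∞)` with limit `+∞`,
then `g(q,x,t) = inf{ y ≥ β(x) : H(q,x,y) ≥ t }` is jointly continuous on `ℝ³`. -/
theorem stmt_7 (H : ℝ → ℝ → ℝ → ℝ)
    (hcont : ContinuousOn (fun p : ℝ × ℝ × ℝ => H p.1 p.2.1 p.2.2)
      {p : ℝ × ℝ × ℝ | beta p.2.1 ≤ p.2.2})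
    (hmono : ∀ q x : ℝ, StrictMonoOn (H q x) (Set.Ici (beta x)))
    (hlim : ∀ q x : ℝ, Filter.Tendsto (H q x) Filter.atTop Filter.atTop) :
    Continuous (fun p : ℝ × ℝ × ℝ =>
      sInf { y : ℝ | beta p.2.1 ≤ y ∧ p.2.2 ≤ H p.1 p.2.1 y }) := by
  have hb : Continuous beta := by unfold beta; fun_prop
  have hF : Continuous (fun p : (ℝ × ℝ × ℝ) × ℝ =>
      H p.1.1 p.1.2.1 (max p.2 (beta p.1.2.1))) := by
    have h2 : Continuous (fun p : (ℝ × ℝ × ℝ) × ℝ =>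
      ((p.1.1, p.1.2.1, max p.2 (beta p.1.2.1)) : ℝ × ℝ × ℝ)) := by fun_prop
    exact hcont.comp_continuous h2 (fun p => le_max_right p.2 (beta p.1.2.1))
  have hne : ∀ p : ℝ × ℝ × ℝ,
      { y : ℝ | beta p.2.1 ≤ y ∧ p.2.2 ≤ H p.1 p.2.1 y }.Nonempty := fun p =>
    ((Filter.eventually_ge_atTop (beta p.2.1)).and
      ((hlim p.1 p.2.1).eventually_ge_atTop p.2.2)).exists
  have hbd : ∀ p : ℝ × ℝ × ℝ,
      BddBelow { y : ℝ | beta p.2.1 ≤ y ∧ p.2.2 ≤ H p.1 p.2.1 y } := fun p =>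
    ⟨beta p.2.1, fun y hy => hy.1⟩
  have hFa : ∀ a : ℝ, Continuous (fun p : ℝ × ℝ × ℝ => H p.1 p.2.1 (max a (beta p.2.1))) :=
    fun a => hF.comp (by fun_prop : Continuous (fun p : ℝ × ℝ × ℝ => (p, a)))
  have hFp : ∀ p : ℝ × ℝ × ℝ, Continuous (fun a : ℝ => H p.1 p.2.1 (max a (beta p.2.1))) :=
    fun p => hF.comp (by fun_prop : Continuous (fun a : ℝ => (p, a)))
  rw [continuous_iff_continuousAt]
  intro p
  refine tendsto_order.2 ⟨fun a ha => ?_, fun a ha => ?_⟩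
  · have hop : IsOpen {p : ℝ × ℝ × ℝ | a < beta p.2.1 ∨
        H p.1 p.2.1 (max a (beta p.2.1)) < p.2.2} :=
      (isOpen_lt (continuous_const : Continuous (fun _ : ℝ × ℝ × ℝ => a))
        (by fun_prop : Continuous (fun p : ℝ × ℝ × ℝ => beta p.2.1))).union
        (isOpen_lt (hFa a) (by fun_prop : Continuous (fun p : ℝ × ℝ × ℝ => p.2.2)))
    have hmem : a < beta p.2.1 ∨ H p.1 p.2.1 (max a (beta p.2.1)) < p.2.2 := by
      by_contra! hc
      rw [max_eq_left hc.1] at hc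
      exact absurd (csInf_le (hbd p) hc) (not_le.2 ha)
    filter_upwards [hop.mem_nhds hmem] with r hr
    rcases hr with hr | hr
    · exact lt_of_lt_of_le hr (le_csInf (hne r) fun y hy => hy.1)
    · have hev := (hFp r).continuousAt.eventually_lt_const hr
      obtain ⟨b, hb1, hb2⟩ :=
        ((hev.filter_mono nhdsWithin_le_nhds).and
          (self_mem_nhdsWithin : Set.Ioi a ∈ nhdsWithin a (Set.Ioi a))).exists
      refine lt_of_lt_of_le hb2 (le_csInf (hne r) fun y hy => ?_)
      by_contra! hlt
      have := (hmono r.1 r.2.1).monotoneOn (Set.mem_Ici.2 hy.1)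
        (Set.mem_Ici.2 (le_max_right b _)) (hlt.le.trans (le_max_left _ _))
      linarith [hy.2]
  · have hop : IsOpen {p : ℝ × ℝ × ℝ | beta p.2.1 < a ∧
        p.2.2 < H p.1 p.2.1 (max a (beta p.2.1))} :=
      (isOpen_lt (by fun_prop : Continuous (fun p : ℝ × ℝ × ℝ => beta p.2.1))
        (continuous_const : Continuous (fun _ : ℝ × ℝ × ℝ => a))).inter
        (isOpen_lt (by fun_prop : Continuous (fun p : ℝ × ℝ × ℝ => p.2.2)) (hFa a))
    have hmem : beta p.2.1 < a ∧ p.2.2 < H p.1 p.2.1 (max a (beta p.2.1)) := by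
      obtain ⟨y, hy, hya⟩ := exists_lt_of_csInf_lt (hne p) ha
      have h1 : beta p.2.1 < a := lt_of_le_of_lt hy.1 hya
      refine ⟨h1, ?_⟩
      rw [max_eq_left h1.le]
      exact lt_of_le_of_lt hy.2 (hmono p.1 p.2.1 hy.1 h1.le hya)
    filter_upwards [hop.mem_nhds hmem] with r hr
    have hev := (hFp r).continuousAt.eventually_const_lt hr.2
    obtain ⟨b, ⟨hb1, hb3⟩, hb2⟩ :=
      (((hev.and (lt_mem_nhds hr.1)).filter_mono nhdsWithin_le_nhds).and
        (self_mem_nhdsWithin : Set.Iio a ∈ nhdsWithin a (Set.Iio a))).exists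
    rw [max_eq_left (le_of_lt hb3)] at hb1
    exact lt_of_le_of_lt (csInf_le (hbd r) ⟨le_of_lt hb3, hb1.le⟩) hb2
end

section
/- Let v₀: ℝ → ℝ be nondecreasing and 1-Lipschitz, let rL < rU be reals, x ∈ ℝ, and let g : [rL, rU] → ℝ be continuous with g(q) ≥ max(0, q−x) for all q. Set F(q) := v₀(q) − g(q), A₀ := { q ∈ [rL,rU] : q ≤ x and g(q) = 0 }, and A₁ := { q ∈ [rL,rU] : q ≥ x and g(q) = q − x }. Then max_{q∈[rL,rU]} F(q) = max of F over [rL,rU] ∖ ( int A₀ ∪ int A₁ ). In particular there exists a maximiser q* of F on [rL,rU] such that either g(q*) > max(0, q*−x), or q* is an endpoint of a connected component of A₀ or of A₁. -/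
theorem comp_closed {A : Set ℝ} (hA : IsClosed A) {q : ℝ} (hq : q ∈ A) :
    IsClosed (connectedComponentIn A q) := by
  apply isClosed_of_closure_subset
  apply isPreconnected_connectedComponentIn.closure.subset_connectedComponentIn
  · exact subset_closure (mem_connectedComponentIn hq)
  · exact closure_minimal (connectedComponentIn_subset A q) hA

theorem comp_ball {A : Set ℝ} {s : ℝ} (hs : s ∈ interior A) :
    ∃ ε > 0, Metric.ball s ε ⊆ connectedComponentIn A s := by
  obtain ⟨ε, hε, h⟩ := Metric.isOpen_iff.1 isOpen_interior s hs
  exact ⟨ε, hε, (convex_ball s ε).isPreconnected.subset_connectedComponentIn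
    (Metric.mem_ball_self hε) (h.trans interior_subset)⟩

theorem comp_sup {A : Set ℝ} (hA : IsCompact A) {q : ℝ} (hq : q ∈ A) :
    ∃ s ∈ A, q ≤ s ∧ s = sSup (connectedComponentIn A s) ∧ s ∉ interior A := by
  have hC : IsCompact (connectedComponentIn A q) :=
    hA.of_isClosed_subset (comp_closed hA.isClosed hq) (connectedComponentIn_subset A q)
  have hm := hC.sSup_mem ⟨q, mem_connectedComponentIn hq⟩
  have he := connectedComponentIn_eq hm
  refine ⟨_, connectedComponentIn_subset A q hm,
    le_csSup hC.bddAbove (mem_connectedComponentIn hq), by rw [← he], fun hi => ?_⟩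
  obtain ⟨ε, hε, h⟩ := comp_ball hi
  rw [← he] at h
  have := le_csSup hC.bddAbove (h (show sSup (connectedComponentIn A q) + ε / 2 ∈ _ by
    rw [Metric.mem_ball, Real.dist_eq, add_sub_cancel_left, abs_of_pos (by linarith)]; linarith))
  linarith

theorem comp_inf {A : Set ℝ} (hA : IsCompact A) {q : ℝ} (hq : q ∈ A) :
    ∃ s ∈ A, s ≤ q ∧ s = sInf (connectedComponentIn A s) ∧ s ∉ interior A := by
  have hC : IsCompact (connectedComponentIn A q) :=
    hA.of_isClosed_subset (comp_closed hA.isClosed hq) (connectedComponentIn_subset A q)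
  have hm := hC.sInf_mem ⟨q, mem_connectedComponentIn hq⟩
  have he := connectedComponentIn_eq hm
  refine ⟨_, connectedComponentIn_subset A q hm,
    csInf_le hC.bddBelow (mem_connectedComponentIn hq), by rw [← he], fun hi => ?_⟩
  obtain ⟨ε, hε, h⟩ := comp_ball hi
  rw [← he] at h
  have := csInf_le hC.bddBelow (h (show sInf (connectedComponentIn A q) - ε / 2 ∈ _ by
    rw [Metric.mem_ball, Real.dist_eq, abs_sub_comm, sub_sub_cancel,
      abs_of_pos (by linarith)]; linarith))
  linarith

/-- Reduction of the variational maximisation away from the interiors of the two contact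
sets, and existence of a maximiser which is either off-contact or an endpoint of a
connected component of a contact set. -/
theorem stmt_8 (v₀ : ℝ → ℝ) (hmono : Monotone v₀) (hlip : LipschitzWith 1 v₀)
    (rL rU x : ℝ) (hr : rL < rU)
    (g : ℝ → ℝ) (hg : ContinuousOn g (Set.Icc rL rU))
    (hge : ∀ q ∈ Set.Icc rL rU, max 0 (q - x) ≤ g q) :
    sSup ((fun q => v₀ q - g q) '' Set.Icc rL rU) =
      sSup ((fun q => v₀ q - g q) ''
        (Set.Icc rL rU \
          (interior {q | q ∈ Set.Icc rL rU ∧ q ≤ x ∧ g q = 0} ∪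
           interior {q | q ∈ Set.Icc rL rU ∧ x ≤ q ∧ g q = q - x}))) ∧
    ∃ qs ∈ Set.Icc rL rU,
      (∀ q ∈ Set.Icc rL rU, v₀ q - g q ≤ v₀ qs - g qs) ∧
      (max 0 (qs - x) < g qs ∨
        (qs ∈ {q | q ∈ Set.Icc rL rU ∧ q ≤ x ∧ g q = 0} ∧
          (qs = sInf (connectedComponentIn {q | q ∈ Set.Icc rL rU ∧ q ≤ x ∧ g q = 0} qs) ∨
           qs = sSup (connectedComponentIn {q | q ∈ Set.Icc rL rU ∧ q ≤ x ∧ g q = 0} qs))) ∨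
        (qs ∈ {q | q ∈ Set.Icc rL rU ∧ x ≤ q ∧ g q = q - x} ∧
          (qs = sInf (connectedComponentIn {q | q ∈ Set.Icc rL rU ∧ x ≤ q ∧ g q = q - x} qs) ∨
           qs = sSup (connectedComponentIn {q | q ∈ Set.Icc rL rU ∧ x ≤ q ∧ g q = q - x} qs)))) := by
  set A₀ := {q | q ∈ Set.Icc rL rU ∧ q ≤ x ∧ g q = 0} with hA₀
  set A₁ := {q | q ∈ Set.Icc rL rU ∧ x ≤ q ∧ g q = q - x} with hA₁
  have c₀ : IsCompact A₀ := by
    apply isCompact_Icc.of_isClosed_subset _ (fun q hq => hq.1)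
    have h := (hg.preimage_isClosed_of_isClosed isClosed_Icc
      (isClosed_singleton (x := (0:ℝ)))).inter (isClosed_Iic (a := x))
    convert h using 1
    ext q
    simp only [hA₀, Set.mem_setOf_eq, Set.mem_inter_iff, Set.mem_preimage, Set.mem_singleton_iff,
      Set.mem_Iic]
    tauto
  have c₁ : IsCompact A₁ := by
    apply isCompact_Icc.of_isClosed_subset _ (fun q hq => hq.1)
    have hg' : ContinuousOn (fun q => g q - (q - x)) (Set.Icc rL rU) := hg.sub (by fun_prop)
    have h := (hg'.preimage_isClosed_of_isClosed isClosed_Icc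
      (isClosed_singleton (x := (0:ℝ)))).inter (isClosed_Ici (a := x))
    convert h using 1
    ext q
    simp only [hA₁, Set.mem_setOf_eq, Set.mem_inter_iff, Set.mem_preimage, Set.mem_singleton_iff,
      Set.mem_Ici, sub_eq_zero]
    tauto
  have i₀ : ∀ q ∈ interior A₀, q < x := by
    intro q hq
    have : q ∈ interior (Set.Iic x) := interior_mono (fun y hy => hy.2.1) hq
    simpa using this
  have i₁ : ∀ q ∈ interior A₁, x < q := by
    intro q hq
    have : q ∈ interior (Set.Ici x) := interior_mono (fun y hy => hy.2.1) hq
    simpa using this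
  obtain ⟨q₀, hq₀, hmax⟩ := isCompact_Icc.exists_isMaxOn (Set.nonempty_Icc.2 hr.le)
    (hlip.continuous.continuousOn.sub hg)
  have hmax : ∀ q ∈ Set.Icc rL rU, v₀ q - g q ≤ v₀ q₀ - g q₀ := fun q hq => hmax hq
  suffices H : ∃ qs ∈ Set.Icc rL rU, (∀ q ∈ Set.Icc rL rU, v₀ q - g q ≤ v₀ qs - g qs) ∧
      qs ∉ interior A₀ ∪ interior A₁ ∧
      (max 0 (qs - x) < g qs ∨
        (qs ∈ A₀ ∧ (qs = sInf (connectedComponentIn A₀ qs) ∨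
           qs = sSup (connectedComponentIn A₀ qs))) ∨
        (qs ∈ A₁ ∧ (qs = sInf (connectedComponentIn A₁ qs) ∨
           qs = sSup (connectedComponentIn A₁ qs)))) by
    obtain ⟨s, hs, hsm, hsi, hsd⟩ := H
    refine ⟨?_, s, hs, hsm, hsd⟩
    have e1 : IsGreatest ((fun q => v₀ q - g q) '' Set.Icc rL rU) (v₀ s - g s) :=
      ⟨⟨s, hs, rfl⟩, by rintro _ ⟨q, hq, rfl⟩; exact hsm q hq⟩
    have e2 : IsGreatest ((fun q => v₀ q - g q) ''
        (Set.Icc rL rU \ (interior A₀ ∪ interior A₁))) (v₀ s - g s) :=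
      ⟨⟨s, ⟨hs, hsi⟩, rfl⟩, by rintro _ ⟨q, hq, rfl⟩; exact hsm q hq.1⟩
    rw [e1.csSup_eq, e2.csSup_eq]
  by_cases h0 : q₀ ∈ A₀
  · obtain ⟨s, hs, hle, hsup, hni⟩ := comp_sup c₀ h0
    refine ⟨s, hs.1, fun q hq => (hmax q hq).trans ?_, ?_, Or.inr (Or.inl ⟨hs, Or.inr hsup⟩)⟩
    · rw [h0.2.2, hs.2.2]
      linarith [hmono hle]
    · rintro (h | h)
      · exact hni h
      · exact absurd (i₁ s h) (not_lt.2 hs.2.1)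
  by_cases h1 : q₀ ∈ A₁
  · obtain ⟨s, hs, hle, hinf, hni⟩ := comp_inf c₁ h1
    refine ⟨s, hs.1, fun q hq => (hmax q hq).trans ?_, ?_, Or.inr (Or.inr ⟨hs, Or.inl hinf⟩)⟩
    · rw [h1.2.2, hs.2.2]
      have := hlip.dist_le_mul q₀ s
      rw [Real.dist_eq, Real.dist_eq, abs_of_nonneg (sub_nonneg.2 hle)] at this
      have h2 := (le_abs_self _).trans this
      simp only [NNReal.coe_one, one_mul] at h2
      linarith
    · rintro (h | h)
      · exact absurd (i₀ s h) (not_lt.2 hs.2.1)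
      · exact hni h
  refine ⟨q₀, hq₀, hmax, ?_, Or.inl ?_⟩
  · rintro (h | h)
    · exact h0 (interior_subset h)
    · exact h1 (interior_subset h)
  · refine lt_of_le_of_ne (hge q₀ hq₀) fun h => ?_
    rcases le_total q₀ x with hx | hx
    · exact h0 ⟨hq₀, hx, by rw [← h]; exact max_eq_left (by linarith)⟩
    · exact h1 ⟨hq₀, hx, by rw [← h]; exact max_eq_right (by linarith)⟩
end

section
/- Let c be a speed function and v₀ nondecreasing and 1-Lipschitz. Fix z, x ∈ ℝ and t > 0; assume for every r the map y ↦ Γ_c^z(r+y,y) is continuous on [β(r),∞) with nonempty superlevel set { y : Γ_c^z(r+y,y) ≥ t }, and assume the level-curve identity Γ_c^z( x − z + g^z(x−z,t), g^z(x−z,t) ) = t. Write g := g^z(x−z,t) and let A := { (u,w) ∈ ℝ² : z − v₀(z) ≤ u + w ≤ x + g − v₀(z) and −v₀(z) ≤ w ≤ g − v₀(z) } be the (possibly degenerate) parallelogram. Then the lifted level curve { (u, g^z(u−z,t) − v₀(z)) : u ∈ ℝ } meets A only at the single point (x, g − v₀(z)); every other point of A lies strictly below the lifted level curve. -/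
open MeasureTheory

/-- `ψ(y)`: the negative Legendre dual of the TASEP flux, given piecewise. -/
noncomputable def psi (y : ℝ) : ℝ :=
  if y < -1 then -y else if y ≤ 1 then (1 - y) ^ 2 / 4 else 0

/-- The homogeneous exponential last-passage shape function `γ(x,y) = (√x + √y)²`. -/
noncomputable def gam (x y : ℝ) : ℝ := (Real.sqrt x + Real.sqrt y) ^ 2

/-- A speed function: Borel measurable, strictly positive, and on every compact set
bounded above and bounded below away from `0`. -/
def SpeedFunction (c : ℝ × ℝ → ℝ) : Prop :=
  Measurable c ∧ (∀ z, 0 < c z) ∧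
    ∀ K : Set (ℝ × ℝ), IsCompact K →
      ∃ m M : ℝ, 0 < m ∧ ∀ z ∈ K, m ≤ c z ∧ c z ≤ M

/-- An admissible macroscopic path from `A` to `B`: continuous on `[0,1]`, piecewise `C¹`
(differentiable off a finite set), with nonnegative derivative components. -/
structure AdmissiblePath (A B : ℝ × ℝ) where
  p : ℝ → ℝ × ℝ
  cont : ContinuousOn p (Set.Icc 0 1)
  init : p 0 = A
  ep : p 1 = B
  pw : ∃ T : Finset ℝ, ∀ s ∈ Set.Ioo (0 : ℝ) 1, s ∉ T →
    DifferentiableAt ℝ p s ∧ 0 ≤ (deriv p s).1 ∧ 0 ≤ (deriv p s).2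

/-- The weight `∫₀¹ γ(x₁′(s), x₂′(s)) / c(x(s)) ds` collected by a path. -/
noncomputable def pathWeight (c : ℝ × ℝ → ℝ) (p : ℝ → ℝ × ℝ) : ℝ :=
  ∫ s in (0 : ℝ)..1, gam (deriv p s).1 (deriv p s).2 / c (p s)

/-- The macroscopic two-point last-passage value `Γ_c(A,B)`, a supremum over admissible
paths from `A` to `B`. -/
noncomputable def Gamma (c : ℝ × ℝ → ℝ) (A B : ℝ × ℝ) : ℝ :=
  sSup { w : ℝ | ∃ P : AdmissiblePath A B, w = pathWeight c P.p }

/-- The `q`-shifted shape function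
`Γ_c^q(x,y) = Γ_c((q − v₀(q), −v₀(q)), (x + q − v₀(q), y − v₀(q)))`. -/
noncomputable def GammaQ (c : ℝ × ℝ → ℝ) (v₀ : ℝ → ℝ) (q x y : ℝ) : ℝ :=
  Gamma c (q - v₀ q, -v₀ q) (x + q - v₀ q, y - v₀ q)

/-- The level curve `g^q(x,t) = inf{ y ≥ β(x) : Γ_c^q(x+y, y) ≥ t }`. -/
noncomputable def levelCurve (c : ℝ × ℝ → ℝ) (v₀ : ℝ → ℝ) (q x t : ℝ) : ℝ :=
  sInf { y : ℝ | beta x ≤ y ∧ t ≤ GammaQ c v₀ q (x + y) y }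

lemma aux_le (f : ℝ → ℝ) (T : Finset ℝ) : ∀ a b : ℝ, a ≤ b → ContinuousOn f (Set.Icc a b) →
    (∀ s ∈ Set.Ioo a b, s ∉ T → DifferentiableAt ℝ f s ∧ 0 ≤ deriv f s) → f a ≤ f b := by
  classical
  induction T using Finset.induction_on with
  | empty =>
    intro a b hab hc hd
    have : MonotoneOn f (Set.Icc a b) := by
      apply monotoneOn_of_deriv_nonneg (convex_Icc a b) hc
      · intro s hs
        rw [interior_Icc] at hs
        exact (hd s hs (by simp)).1.differentiableWithinAt
      · intro s hs
        rw [interior_Icc] at hs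
        exact (hd s hs (by simp)).2
    exact this (Set.left_mem_Icc.2 hab) (Set.right_mem_Icc.2 hab) hab
  | insert τ T _ ih =>
    intro a b hab hc hd
    by_cases hτ : τ ∈ Set.Ioo a b
    · have h1 := ih a τ hτ.1.le (hc.mono (Set.Icc_subset_Icc le_rfl hτ.2.le)) (by
        intro s hs hsT
        refine hd s ⟨hs.1, hs.2.trans hτ.2⟩ ?_
        simp only [Finset.mem_insert, not_or]
        exact ⟨hs.2.ne, hsT⟩)
      have h2 := ih τ b hτ.2.le (hc.mono (Set.Icc_subset_Icc hτ.1.le le_rfl)) (by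
        intro s hs hsT
        refine hd s ⟨hτ.1.trans hs.1, hs.2⟩ ?_
        simp only [Finset.mem_insert, not_or]
        exact ⟨hs.1.ne', hsT⟩)
      exact h1.trans h2
    · apply ih a b hab hc
      intro s hs hsT
      refine hd s hs ?_
      simp only [Finset.mem_insert, not_or]
      refine ⟨?_, hsT⟩
      rintro rfl
      exact hτ hs

lemma aux_mono (f : ℝ → ℝ) (T : Finset ℝ) (hc : ContinuousOn f (Set.Icc 0 1))
    (hd : ∀ s ∈ Set.Ioo (0:ℝ) 1, s ∉ T → DifferentiableAt ℝ f s ∧ 0 ≤ deriv f s) :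
    MonotoneOn f (Set.Icc 0 1) := by
  intro a ha b hb hab
  apply aux_le f T a b hab (hc.mono (Set.Icc_subset_Icc ha.1 hb.2))
  intro s hs
  exact hd s ⟨ha.1.trans_lt hs.1, hs.2.trans_le hb.2⟩

lemma deriv_fst_aux {p : ℝ → ℝ × ℝ} {s : ℝ} (h : DifferentiableAt ℝ p s) :
    HasDerivAt (fun s => (p s).1) (deriv p s).1 s ∧
    HasDerivAt (fun s => (p s).2) (deriv p s).2 s :=
  ⟨(hasFDerivAt_fst (𝕜 := ℝ) (p := p s)).comp_hasDerivAt s h.hasDerivAt,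
   (hasFDerivAt_snd (𝕜 := ℝ) (p := p s)).comp_hasDerivAt s h.hasDerivAt⟩

lemma path_mono {A B : ℝ × ℝ} (P : AdmissiblePath A B) :
    MonotoneOn (fun s => (P.p s).1) (Set.Icc 0 1) ∧
    MonotoneOn (fun s => (P.p s).2) (Set.Icc 0 1) := by
  obtain ⟨T, hT⟩ := P.pw
  constructor
  · apply aux_mono _ T (continuous_fst.comp_continuousOn P.cont)
    intro s hs hsT
    obtain ⟨h1, h2, h3⟩ := hT s hs hsT
    have := (deriv_fst_aux h1).1
    exact ⟨this.differentiableAt, h2.trans_eq this.deriv.symm⟩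
  · apply aux_mono _ T (continuous_snd.comp_continuousOn P.cont)
    intro s hs hsT
    obtain ⟨h1, h2, h3⟩ := hT s hs hsT
    have := (deriv_fst_aux h1).2
    exact ⟨this.differentiableAt, h3.trans_eq this.deriv.symm⟩

lemma gam_nonneg (a b : ℝ) : 0 ≤ gam a b := sq_nonneg _

lemma gam_le {a b : ℝ} (ha : 0 ≤ a) (hb : 0 ≤ b) : gam a b ≤ 2 * (a + b) := by
  unfold gam
  nlinarith [Real.sq_sqrt ha, Real.sq_sqrt hb, sq_nonneg (Real.sqrt a - Real.sqrt b)]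

lemma le_gam {a b : ℝ} (ha : 0 ≤ a) (hb : 0 ≤ b) : a + b ≤ gam a b := by
  unfold gam
  nlinarith [Real.sq_sqrt ha, Real.sq_sqrt hb, mul_nonneg (Real.sqrt_nonneg a) (Real.sqrt_nonneg b)]

lemma gam_two (a b : ℝ) : gam (2 * a) (2 * b) = 2 * gam a b := by
  unfold gam
  rw [Real.sqrt_mul (by norm_num), Real.sqrt_mul (by norm_num), ← mul_add, mul_pow,
    Real.sq_sqrt (by norm_num)]

lemma path_int {c : ℝ × ℝ → ℝ} (hc : SpeedFunction c) (A B : ℝ × ℝ) :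
    ∃ C : ℝ, ∀ P : AdmissiblePath A B,
      IntervalIntegrable (fun s => gam (deriv P.p s).1 (deriv P.p s).2 / c (P.p s)) volume 0 1 ∧
      pathWeight c P.p ≤ C := by
  obtain ⟨hmeas, hpos, hK⟩ := hc
  obtain ⟨m, M, hm, hmM⟩ := hK (Set.Icc A B) isCompact_Icc
  refine ⟨2 / m * ((B.1 - A.1) + (B.2 - A.2)), fun P => ?_⟩
  obtain ⟨hm1, hm2⟩ := path_mono P
  have hin : ∀ s ∈ Set.Icc (0:ℝ) 1, P.p s ∈ Set.Icc A B := by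
    intro s hs
    have a1 := hm1 (Set.left_mem_Icc.2 zero_le_one) hs hs.1
    have a2 := hm2 (Set.left_mem_Icc.2 zero_le_one) hs hs.1
    have a3 := hm1 hs (Set.right_mem_Icc.2 zero_le_one) hs.2
    have a4 := hm2 hs (Set.right_mem_Icc.2 zero_le_one) hs.2
    simp only [P.init, P.ep] at a1 a2 a3 a4
    exact ⟨⟨a1, a2⟩, ⟨a3, a4⟩⟩
  obtain ⟨T, hT⟩ := P.pw
  have e01 : Set.uIcc (0:ℝ) 1 = Set.Icc 0 1 := Set.uIcc_of_le zero_le_one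
  have i1 := MonotoneOn.intervalIntegrable_deriv (e01 ▸ hm1)
  have i2 := MonotoneOn.intervalIntegrable_deriv (e01 ▸ hm2)
  have j1 := MonotoneOn.intervalIntegral_deriv_mem_uIcc (e01 ▸ hm1)
  have j2 := MonotoneOn.intervalIntegral_deriv_mem_uIcc (e01 ▸ hm2)
  have b1 := hm1 (Set.left_mem_Icc.2 zero_le_one) (Set.right_mem_Icc.2 zero_le_one) zero_le_one
  have b2 := hm2 (Set.left_mem_Icc.2 zero_le_one) (Set.right_mem_Icc.2 zero_le_one) zero_le_one
  simp only [P.init, P.ep] at j1 j2 b1 b2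
  rw [Set.uIcc_of_le (by linarith)] at j1 j2
  have iD := (i1.add i2).const_mul (2 / m)
  have hbad : ∀ᵐ s : ℝ ∂volume, s ∉ (T : Set ℝ) ∪ {1} :=
    ((T.finite_toSet.union (Set.finite_singleton 1)).countable).ae_notMem volume
  have hbound : ∀ᵐ s : ℝ ∂volume, s ∈ Set.Ioc (0:ℝ) 1 →
      gam (deriv P.p s).1 (deriv P.p s).2 / c (P.p s) ≤
        2 / m * (deriv (fun s => (P.p s).1) s + deriv (fun s => (P.p s).2) s) := by
    filter_upwards [hbad] with s hs hs01
    simp only [Set.mem_union, Finset.mem_coe, Set.mem_singleton_iff, not_or] at hs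
    obtain ⟨h1, h2, h3⟩ := hT s ⟨hs01.1, lt_of_le_of_ne hs01.2 hs.2⟩ hs.1
    rw [(deriv_fst_aux h1).1.deriv, (deriv_fst_aux h1).2.deriv]
    have hcm := (hmM _ (hin s ⟨hs01.1.le, hs01.2⟩)).1
    calc _ ≤ gam (deriv P.p s).1 (deriv P.p s).2 / m :=
          div_le_div_of_nonneg_left (gam_nonneg _ _) hm hcm
      _ ≤ (2 * ((deriv P.p s).1 + (deriv P.p s).2)) / m :=
          div_le_div_of_nonneg_right (gam_le h2 h3) hm.le
      _ = _ := by ring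
  have hint : IntervalIntegrable
      (fun s => gam (deriv P.p s).1 (deriv P.p s).2 / c (P.p s)) volume 0 1 := by
    refine iD.mono_fun ?_ ?_
    · have hd := measurable_deriv P.p
      rw [Set.uIoc_of_le zero_le_one]
      have hp : AEMeasurable P.p (volume.restrict (Set.Ioc 0 1)) :=
        (P.cont.mono Set.Ioc_subset_Icc_self).aemeasurable measurableSet_Ioc
      have hg : Measurable (fun s => gam (deriv P.p s).1 (deriv P.p s).2) := by
        unfold gam
        fun_prop
      exact (hg.aemeasurable.div (hmeas.comp_aemeasurable hp)).aestronglyMeasurable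
    · rw [Set.uIoc_of_le zero_le_one, Filter.EventuallyLE, ae_restrict_iff' measurableSet_Ioc]
      filter_upwards [hbound] with s hs hs01
      rw [Real.norm_of_nonneg (div_nonneg (gam_nonneg _ _) (hpos _).le)]
      exact (hs hs01).trans (le_abs_self _)
  refine ⟨hint, ?_⟩
  unfold pathWeight
  calc _ ≤ ∫ s in (0:ℝ)..1,
          2 / m * (deriv (fun s => (P.p s).1) s + deriv (fun s => (P.p s).2) s) := by
        apply intervalIntegral.integral_mono_ae_restrict zero_le_one hint iD
        rw [Filter.EventuallyLE, ae_restrict_iff' measurableSet_Icc]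
        have h0 : ∀ᵐ s : ℝ ∂volume, s ≠ 0 := by
          simpa using (Set.countable_singleton (0:ℝ)).ae_notMem volume
        filter_upwards [hbound, h0] with s hs hs0 hs01
        exact hs ⟨lt_of_le_of_ne hs01.1 (Ne.symm hs0), hs01.2⟩
    _ = 2 / m * ((∫ s in (0:ℝ)..1, deriv (fun s => (P.p s).1) s) +
          ∫ s in (0:ℝ)..1, deriv (fun s => (P.p s).2) s) := by
        rw [intervalIntegral.integral_const_mul, intervalIntegral.integral_add i1 i2]
    _ ≤ _ := by
        have : 0 ≤ 2 / m := by positivity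
        exact mul_le_mul_of_nonneg_left (add_le_add j1.2 j2.2) this

noncomputable def linePath {A B : ℝ × ℝ} (h : A ≤ B) : AdmissiblePath A B where
  p := fun s => A + s • (B - A)
  cont := by fun_prop
  init := by simp
  ep := by simp
  pw := by
    refine ⟨∅, fun s _ _ => ?_⟩
    have hd : HasDerivAt (fun s : ℝ => A + s • (B - A)) (B - A) s := by
      simpa using ((hasDerivAt_id s).smul_const (B - A)).const_add A
    rw [hd.deriv]
    exact ⟨hd.differentiableAt, sub_nonneg.2 h.1, sub_nonneg.2 h.2⟩

noncomputable def catFun (p : ℝ → ℝ × ℝ) (A B : ℝ × ℝ) : ℝ → ℝ × ℝ :=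
  fun s => if s ≤ 1 / 2 then p (2 * s) else A + (2 * s - 1) • (B - A)

lemma catFun_left (p : ℝ → ℝ × ℝ) (A B : ℝ × ℝ) {s : ℝ} (hs : s < 1 / 2) :
    catFun p A B =ᶠ[nhds s] fun s => p (2 * s) := by
  filter_upwards [Iio_mem_nhds hs] with r hr
  simp only [catFun]
  rw [if_pos (le_of_lt hr)]

lemma catFun_right (p : ℝ → ℝ × ℝ) (A B : ℝ × ℝ) {s : ℝ} (hs : 1 / 2 < s) :
    HasDerivAt (catFun p A B) ((2:ℝ) • (B - A)) s := by
  have h1 : catFun p A B =ᶠ[nhds s] fun s => A + (2 * s - 1) • (B - A) := by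
    filter_upwards [Ioi_mem_nhds hs] with r hr
    simp only [catFun]
    rw [if_neg (not_le.2 hr)]
  refine HasDerivAt.congr_of_eventuallyEq ?_ h1
  have h2 : HasDerivAt (fun s : ℝ => 2 * s - 1) 2 s := by
    simpa using ((hasDerivAt_id s).const_mul 2).sub_const 1
  exact (h2.smul_const (B - A)).const_add A

lemma catFun_left_deriv (p : ℝ → ℝ × ℝ) (A B : ℝ × ℝ) {s : ℝ} (hs : s < 1 / 2) :
    deriv (catFun p A B) s = (2:ℝ) • deriv p (2 * s) := by
  rw [(catFun_left p A B hs).deriv_eq]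
  exact deriv_comp_mul_left 2 p s

noncomputable def catPath {O A B : ℝ × ℝ} (P : AdmissiblePath O A) (h : A ≤ B) :
    AdmissiblePath O B where
  p := catFun P.p A B
  cont := by
    unfold catFun
    apply ContinuousOn.if
    · intro a ha
      have hf : a ∈ frontier {a : ℝ | a ≤ 1 / 2} := ha.2
      have : frontier {a : ℝ | a ≤ 1 / 2} = {1 / 2} := frontier_Iic
      rw [this] at hf
      rw [Set.mem_singleton_iff.1 hf]
      simp [P.ep]
    · refine P.cont.comp (by fun_prop) ?_
      intro s hs
      have h2 : s ∈ closure (Set.Iic (1 / 2 : ℝ)) := hs.2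
      rw [closure_Iic] at h2
      have h2' : s ≤ 1 / 2 := h2
      exact ⟨by linarith [hs.1.1], by linarith⟩
    · fun_prop
  init := by simp [catFun, P.init]
  ep := by
    norm_num [catFun]
  pw := by
    classical
    obtain ⟨T, hT⟩ := P.pw
    refine ⟨insert (1 / 2) (T.image (fun r => r / 2)), fun s hs hsT => ?_⟩
    simp only [Finset.mem_insert, Finset.mem_image, not_or, not_exists, not_and] at hsT
    rcases lt_or_gt_of_ne hsT.1 with hlt | hgt
    · obtain ⟨h1, h2, h3⟩ := hT (2 * s) ⟨by linarith [hs.1], by linarith⟩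
        (fun hm => hsT.2 _ hm (by ring))
      refine ⟨?_, ?_⟩
      · refine DifferentiableAt.congr_of_eventuallyEq ?_ (catFun_left P.p A B hlt)
        exact DifferentiableAt.comp s h1 (by fun_prop)
      · rw [catFun_left_deriv P.p A B hlt]
        simp only [Prod.smul_fst, Prod.smul_snd, smul_eq_mul]
        exact ⟨by positivity, by positivity⟩
    · have hd := catFun_right P.p A B hgt
      rw [hd.deriv]
      have e1 : 0 ≤ B.1 - A.1 := sub_nonneg.2 h.1
      have e2 : 0 ≤ B.2 - A.2 := sub_nonneg.2 h.2
      refine ⟨hd.differentiableAt, ?_⟩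
      simp only [Prod.smul_fst, Prod.smul_snd, smul_eq_mul, Prod.fst_sub, Prod.snd_sub]
      exact ⟨by positivity, by positivity⟩

lemma Gamma_strict {c : ℝ × ℝ → ℝ} (hc : SpeedFunction c) {O A B : ℝ × ℝ}
    (hOA : O ≤ A) (hAB : A ≤ B) (hne : A ≠ B) : Gamma c O A < Gamma c O B := by
  obtain ⟨C, hC⟩ := path_int hc O B
  have hpos := hc.2.1
  obtain ⟨m, M, hm, hmM⟩ := hc.2.2 (Set.Icc A B) isCompact_Icc
  have hM : 0 < M := hm.trans_le ((hmM A ⟨le_rfl, hAB⟩).1.trans (hmM A ⟨le_rfl, hAB⟩).2)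
  have e1 : 0 ≤ B.1 - A.1 := sub_nonneg.2 hAB.1
  have e2 : 0 ≤ B.2 - A.2 := sub_nonneg.2 hAB.2
  have hG : 0 < gam (B.1 - A.1) (B.2 - A.2) := by
    refine lt_of_lt_of_le ?_ (le_gam e1 e2)
    rcases e1.lt_or_eq with h | h
    · linarith
    · rcases e2.lt_or_eq with h' | h'
      · linarith
      · exact absurd (Prod.ext (by linarith) (by linarith)) hne
  set δ := gam (B.1 - A.1) (B.2 - A.2) / M with hδ
  have hδpos : 0 < δ := div_pos hG hM
  have key : ∀ P : AdmissiblePath O A, pathWeight c P.p + δ ≤ Gamma c O B := by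
    intro P
    have hbdd : BddAbove { w : ℝ | ∃ P : AdmissiblePath O B, w = pathWeight c P.p } :=
      ⟨C, by rintro _ ⟨P, rfl⟩; exact (hC P).2⟩
    refine le_trans ?_ (le_csSup hbdd ⟨catPath P hAB, rfl⟩)
    have hint := (hC (catPath P hAB)).1
    have il := hint.mono_set (c := 0) (d := 1 / 2) (by
      rw [Set.uIcc_of_le (by norm_num), Set.uIcc_of_le (by norm_num)]
      exact Set.Icc_subset_Icc le_rfl (by norm_num))
    have ir := hint.mono_set (c := 1 / 2) (d := 1) (by
      rw [Set.uIcc_of_le (by norm_num), Set.uIcc_of_le (by norm_num)]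
      exact Set.Icc_subset_Icc (by norm_num) le_rfl)
    have hsplit := intervalIntegral.integral_add_adjacent_intervals il ir
    have hL : (∫ s in (0:ℝ)..(1/2), gam (deriv (catPath P hAB).p s).1
        (deriv (catPath P hAB).p s).2 / c ((catPath P hAB).p s)) = pathWeight c P.p := by
      have hh : ∀ᵐ s : ℝ ∂volume, s ≠ 1 / 2 := by
        simpa using (Set.countable_singleton (1 / 2 : ℝ)).ae_notMem volume
      have := intervalIntegral.smul_integral_comp_mul_left (a := 0) (b := 1 / 2)
        (fun s => gam (deriv P.p s).1 (deriv P.p s).2 / c (P.p s)) 2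
      rw [mul_zero, show (2:ℝ) * (1 / 2) = 1 by norm_num] at this
      rw [pathWeight, ← this, smul_eq_mul, ← intervalIntegral.integral_const_mul]
      apply intervalIntegral.integral_congr_ae
      filter_upwards [hh] with s hs hs01
      rw [Set.uIoc_of_le (by norm_num)] at hs01
      have hlt : s < 1 / 2 := lt_of_le_of_ne hs01.2 hs
      have d1 : deriv (catPath P hAB).p s = (2:ℝ) • deriv P.p (2 * s) :=
        catFun_left_deriv P.p A B hlt
      have d2 : (catPath P hAB).p s = P.p (2 * s) := (catFun_left P.p A B hlt).eq_of_nhds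
      rw [d1, d2]
      simp only [Prod.smul_fst, Prod.smul_snd, smul_eq_mul]
      rw [gam_two]
      ring
    have hR : δ ≤ ∫ s in (1/2:ℝ)..1, gam (deriv (catPath P hAB).p s).1
        (deriv (catPath P hAB).p s).2 / c ((catPath P hAB).p s) := by
      have : δ = ∫ s in (1/2:ℝ)..1, 2 * δ := by
        rw [intervalIntegral.integral_const, smul_eq_mul]; ring
      rw [this]
      apply intervalIntegral.integral_mono_on_of_le_Ioo (by norm_num) (by simp) ir
      intro s hs
      have d1 : deriv (catPath P hAB).p s = (2:ℝ) • (B - A) :=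
        (catFun_right P.p A B hs.1).deriv
      have d2 : (catPath P hAB).p s = A + (2 * s - 1) • (B - A) := if_neg (not_le.2 hs.1)
      rw [d1, d2]
      simp only [Prod.smul_fst, Prod.smul_snd, smul_eq_mul, Prod.fst_sub, Prod.snd_sub]
      rw [gam_two, hδ, ← mul_div_assoc]
      apply div_le_div_of_nonneg_left (by positivity) (hpos _)
      apply (hmM _ _).2
      have hs1 := hs.1
      have hs2 := hs.2
      refine ⟨⟨?_, ?_⟩, ⟨?_, ?_⟩⟩ <;>
        simp only [Prod.fst_add, Prod.snd_add, Prod.smul_fst, Prod.smul_snd, smul_eq_mul,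
          Prod.fst_sub, Prod.snd_sub] <;> nlinarith
    rw [hL] at hsplit
    unfold pathWeight at hsplit ⊢
    linarith
  have : Gamma c O A ≤ Gamma c O B - δ := by
    apply csSup_le
    · exact ⟨_, linePath hOA, rfl⟩
    · rintro _ ⟨P, rfl⟩
      linarith [key P]
  linarith

/-- The (possibly degenerate) parallelogram `A` with north-east corner on the lifted level
curve touches the lifted level curve only at that corner; every other point of `A` lies
strictly below the lifted level curve. -/
theorem stmt_10 (c : ℝ × ℝ → ℝ) (hc : SpeedFunction c)
    (v₀ : ℝ → ℝ) (hmono : Monotone v₀) (hlip : LipschitzWith 1 v₀)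
    (z x t : ℝ) (ht : 0 < t)
    (hcont : ∀ r : ℝ,
      ContinuousOn (fun y => GammaQ c v₀ z (r + y) y) (Set.Ici (beta r)))
    (hne : ∀ r : ℝ, {y : ℝ | beta r ≤ y ∧ t ≤ GammaQ c v₀ z (r + y) y}.Nonempty)
    (hlevel : GammaQ c v₀ z (x - z + levelCurve c v₀ z (x - z) t)
      (levelCurve c v₀ z (x - z) t) = t) :
    ∀ u w : ℝ,
      z - v₀ z ≤ u + w → u + w ≤ x + levelCurve c v₀ z (x - z) t - v₀ z →
      -v₀ z ≤ w → w ≤ levelCurve c v₀ z (x - z) t - v₀ z →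
      (u, w) = (x, levelCurve c v₀ z (x - z) t - v₀ z) ∨
        w < levelCurve c v₀ z (u - z) t - v₀ z := by
  intro u w h1 h2 h3 h4
  set g := levelCurve c v₀ z (x - z) t with hg
  by_contra hcon
  rw [not_or, not_lt] at hcon
  obtain ⟨hneq, hle⟩ := hcon
  set S := {y : ℝ | beta (u - z) ≤ y ∧ t ≤ GammaQ c v₀ z (u - z + y) y} with hS
  have hclosed : IsClosed S :=
    (hcont (u - z)).preimage_isClosed_of_isClosed isClosed_Ici isClosed_Ici
  have hmem : levelCurve c v₀ z (u - z) t ∈ S :=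
    hclosed.csInf_mem (hne (u - z)) ⟨beta (u - z), fun y hy => hy.1⟩
  set y := levelCurve c v₀ z (u - z) t with hy
  obtain ⟨hb, hty⟩ := hmem
  have hb1 : 0 ≤ y := (le_max_left _ _).trans hb
  have hb2 : -(u - z) ≤ y := (le_max_right _ _).trans hb
  have hlt : GammaQ c v₀ z (u - z + y) y < GammaQ c v₀ z (x - z + g) g := by
    apply Gamma_strict hc
    · exact ⟨by simp only; linarith, by simp only; linarith⟩
    · exact ⟨by simp only; linarith, by simp only; linarith⟩
    · intro h
      have q1 := congrArg Prod.fst h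
      have q2 := congrArg Prod.snd h
      simp only at q1 q2
      apply hneq
      exact Prod.ext (by simp only; linarith) (by simp only; linarith)
  linarith
end

section
/- Let v : ℝ × (0,∞) → ℝ be jointly locally Lipschitz and such that for each fixed t the map x ↦ v(x,t) is nondecreasing and 1-Lipschitz. Let c̃ : ℝ² → ℝ be a function whose set of discontinuity points is contained, within every compact subset of ℝ², in the union of: finitely many graphs {(x, h(x)) : x ∈ I} of C¹ functions h whose derivative satisfies h′(x) ∉ [−1,0] for a.e. x ∈ I; finitely many vertical line segments; and a countable set of points. Then there is a set D ⊆ ℝ × (0,∞) of full Lebesgue measure, dense in ℝ × (0,∞), such that the composition (x,t) ↦ c̃(x, −v(x,t)) is continuous at every point of D. -/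
open MeasureTheory

lemma aux_countable (g : ℝ → ℝ) :
    {x : ℝ | g x = 0 ∧ ∃ g' : ℝ, g' ≠ 0 ∧ HasDerivAt g g' x}.Countable := by
  set S := {x : ℝ | g x = 0 ∧ ∃ g' : ℝ, g' ≠ 0 ∧ HasDerivAt g g' x} with hS
  have hd : DiscreteTopology S := by
    rw [discreteTopology_subtype_iff]
    rintro x ⟨hx, g', hg', hd⟩
    have h := hd.eventually_ne (c := 0) hg'
    rw [← Filter.empty_mem_iff_bot]
    rw [Filter.mem_inf_principal]
    filter_upwards [h] with y hy hyS
    exact hy hyS.1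
  exact Set.countable_coe_iff.1 (TopologicalSpace.separableSpace_iff_countable.1 inferInstance)

lemma aux_slice (w f : ℝ → ℝ) (a b : ℝ) (hm : Monotone w) (hl : LipschitzWith 1 w)
    (hf : ContDiffOn ℝ 1 f (Set.Icc a b))
    (hf' : ∀ᵐ s ∂volume, s ∈ Set.Ioo a b → deriv f s ∉ Set.Icc (-1 : ℝ) 0) :
    volume {x : ℝ | x ∈ Set.Icc a b ∧ w x + f x = 0} = 0 := by
  have hc := (aux_countable (fun x => w x + f x)).ae_notMem volume
  have ha : ∀ᵐ x : ℝ ∂volume, x ≠ a := by simp [ae_iff]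
  have hb : ∀ᵐ x : ℝ ∂volume, x ≠ b := by simp [ae_iff]
  have hw := hm.ae_differentiableAt
  have : ∀ᵐ x : ℝ ∂volume, ¬ (x ∈ Set.Icc a b ∧ w x + f x = 0) := by
    filter_upwards [hc, ha, hb, hw, hf'] with x hc ha hb hw hf' ⟨hx, h0⟩
    have hx' : x ∈ Set.Ioo a b := ⟨lt_of_le_of_ne hx.1 (Ne.symm ha), lt_of_le_of_ne hx.2 hb⟩
    have hfd : DifferentiableAt ℝ f x :=
      (hf.differentiableOn one_ne_zero).differentiableAt (Icc_mem_nhds hx'.1 hx'.2)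
    apply hc
    refine ⟨h0, deriv w x + deriv f x, ?_, hw.hasDerivAt.add hfd.hasDerivAt⟩
    intro h
    apply hf' hx'
    have h1 : 0 ≤ deriv w x := hm.deriv_nonneg
    have h2 : ‖deriv w x‖ ≤ 1 := by simpa using norm_deriv_le_of_lipschitz (x₀ := x) hl
    have h3 := (abs_le.1 h2).2
    constructor <;> linarith
  simpa only [ae_iff, not_not] using this

lemma aux_graph (v : ℝ → ℝ → ℝ)
    (hcont : ContinuousOn (fun p : ℝ × ℝ => v p.1 p.2) {p | 0 < p.2})
    (hmono : ∀ t : ℝ, 0 < t → Monotone (fun x => v x t))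
    (hlipx : ∀ t : ℝ, 0 < t → LipschitzWith 1 (fun x => v x t))
    (f : ℝ → ℝ) (a b : ℝ)
    (hf : ContDiffOn ℝ 1 f (Set.Icc a b))
    (hf' : ∀ᵐ s ∂volume, s ∈ Set.Ioo a b → deriv f s ∉ Set.Icc (-1 : ℝ) 0) :
    volume {p : ℝ × ℝ | 0 < p.2 ∧ p.1 ∈ Set.Icc a b ∧ v p.1 p.2 + f p.1 = 0} = 0 := by
  have hmeas : MeasurableSet
      {p : ℝ × ℝ | 0 < p.2 ∧ p.1 ∈ Set.Icc a b ∧ v p.1 p.2 + f p.1 = 0} := by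
    have hS : MeasurableSet (Set.Icc a b ×ˢ Set.Ioi (0:ℝ)) :=
      measurableSet_Icc.prod measurableSet_Ioi
    have hg : ContinuousOn (fun p : ℝ × ℝ => v p.1 p.2 + f p.1)
        (Set.Icc a b ×ˢ Set.Ioi (0:ℝ)) := by
      refine (hcont.mono fun p hp => hp.2).add ?_
      exact hf.continuousOn.comp continuousOn_fst fun p hp => hp.1
    obtain ⟨u, hu, hu'⟩ := continuousOn_iff_isClosed.1 hg {0} isClosed_singleton
    convert hu.measurableSet.inter hS using 1
    rw [← hu']
    ext p
    simp only [Set.mem_setOf_eq, Set.mem_inter_iff, Set.mem_preimage, Set.mem_singleton_iff,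
      Set.mem_prod, Set.mem_Ioi]
    tauto
  rw [Measure.volume_eq_prod, Measure.prod_apply_symm hmeas]
  rw [lintegral_eq_zero_of_ae_eq_zero]
  refine Filter.Eventually.of_forall fun t => ?_
  by_cases ht : 0 < t
  · refine measure_mono_null ?_ (aux_slice _ f a b (hmono t ht) (hlipx t ht) hf hf')
    rintro x ⟨-, h⟩
    exact h
  · simp [ht]

lemma aux_vert (C : Set ℝ) (hC : C.Countable) :
    volume {p : ℝ × ℝ | p.1 ∈ C} = 0 := by
  have : {p : ℝ × ℝ | p.1 ∈ C} = C ×ˢ Set.univ := by ext; simp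
  rw [this, Measure.volume_eq_prod, Measure.prod_prod, hC.measure_zero, zero_mul]

/-- Continuity points of the sampled coefficient have full measure and are dense:
if `v` is jointly locally Lipschitz on `ℝ × (0,∞)`, nondecreasing and 1-Lipschitz in the
space variable, and the discontinuity set of `c̃` is locally contained in finitely many
`C¹` graphs with slope a.e. outside `[−1,0]`, finitely many vertical segments, and a
countable set, then `(x,t) ↦ c̃(x, −v(x,t))` is continuous on a dense full-measure set. -/
theorem stmt_14 (v : ℝ → ℝ → ℝ)
    (hloclip : ∀ x t : ℝ, 0 < t → ∃ (K : NNReal) (ε : ℝ), 0 < ε ∧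
      LipschitzOnWith K (fun p : ℝ × ℝ => v p.1 p.2) (Metric.ball (x, t) ε))
    (hmono : ∀ t : ℝ, 0 < t → Monotone (fun x => v x t))
    (hlipx : ∀ t : ℝ, 0 < t → LipschitzWith 1 (fun x => v x t))
    (ct : ℝ × ℝ → ℝ)
    (hdisc : ∀ K : Set (ℝ × ℝ), IsCompact K →
      ∃ (n : ℕ) (aa bb : Fin n → ℝ) (f : Fin n → ℝ → ℝ)
        (m : ℕ) (xs ya yb : Fin m → ℝ) (P : Set (ℝ × ℝ)),
        (∀ i, ContDiffOn ℝ 1 (f i) (Set.Icc (aa i) (bb i))) ∧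
        (∀ i, ∀ᵐ s ∂volume, s ∈ Set.Ioo (aa i) (bb i) →
          deriv (f i) s ∉ Set.Icc (-1 : ℝ) 0) ∧
        P.Countable ∧
        {z : ℝ × ℝ | z ∈ K ∧ ¬ ContinuousAt ct z} ⊆
          (⋃ i, {p : ℝ × ℝ | p.1 ∈ Set.Icc (aa i) (bb i) ∧ p.2 = f i p.1}) ∪
          (⋃ j, {p : ℝ × ℝ | p.1 = xs j ∧ p.2 ∈ Set.Icc (ya j) (yb j)}) ∪ P) :
    ∃ D : Set (ℝ × ℝ),
      D ⊆ {p : ℝ × ℝ | 0 < p.2} ∧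
      volume ({p : ℝ × ℝ | 0 < p.2} \ D) = 0 ∧
      {p : ℝ × ℝ | 0 < p.2} ⊆ closure D ∧
      ∀ p ∈ D, ContinuousAt (fun q : ℝ × ℝ => ct (q.1, -v q.1 q.2)) p := by
  have hca : ∀ p : ℝ × ℝ, 0 < p.2 → ContinuousAt (fun p : ℝ × ℝ => v p.1 p.2) p := by
    rintro ⟨x, t⟩ ht
    obtain ⟨K, ε, hε, hL⟩ := hloclip x t ht
    exact hL.continuousOn.continuousAt (Metric.ball_mem_nhds _ hε)
  have hcont : ContinuousOn (fun p : ℝ × ℝ => v p.1 p.2) {p | 0 < p.2} :=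
    fun p hp => (hca p hp).continuousWithinAt
  have hopen : IsOpen {p : ℝ × ℝ | 0 < p.2} := isOpen_lt continuous_const continuous_snd
  set D : Set (ℝ × ℝ) := {p | 0 < p.2 ∧ ContinuousAt ct (p.1, -v p.1 p.2)} with hD
  have hnull : volume ({p : ℝ × ℝ | 0 < p.2} \ D) = 0 := by
    have hsub : ({p : ℝ × ℝ | 0 < p.2} \ D) ⊆ ⋃ N : ℕ, {p : ℝ × ℝ | 0 < p.2 ∧
        (p.1, -v p.1 p.2) ∈ {z : ℝ × ℝ | z ∈ Metric.closedBall (0 : ℝ × ℝ) N ∧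
          ¬ ContinuousAt ct z}} := by
      rintro p ⟨hp, hpD⟩
      obtain ⟨N, hN⟩ := exists_nat_ge ‖((p.1, -v p.1 p.2) : ℝ × ℝ)‖
      refine Set.mem_iUnion.2 ⟨N, hp, ?_, fun h => hpD ⟨hp, h⟩⟩
      simpa only [mem_closedBall_zero_iff] using hN
    refine measure_mono_null hsub (measure_iUnion_null fun N => ?_)
    obtain ⟨n, aa, bb, f, m, xs, ya, yb, P, hf, hf', hP, hcov⟩ :=
      hdisc (Metric.closedBall 0 N) (isCompact_closedBall _ _)
    have h1 : volume (⋃ i, {p : ℝ × ℝ | 0 < p.2 ∧ p.1 ∈ Set.Icc (aa i) (bb i) ∧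
        v p.1 p.2 + f i p.1 = 0}) = 0 :=
      measure_iUnion_null fun i => aux_graph v hcont hmono hlipx _ _ _ (hf i) (hf' i)
    have h2 := aux_vert (Set.range xs ∪ Prod.fst '' P)
      ((Set.countable_range xs).union (hP.image _))
    refine measure_mono_null ?_ (measure_union_null h1 h2)
    rintro p ⟨hp, hz⟩
    rcases hcov hz with (h | h) | h
    · left
      obtain ⟨i, hi⟩ := Set.mem_iUnion.1 h
      refine Set.mem_iUnion.2 ⟨i, hp, hi.1, ?_⟩
      have := hi.2
      simp only at this
      linarith
    · right
      obtain ⟨j, hj⟩ := Set.mem_iUnion.1 h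
      exact Or.inl ⟨j, hj.1.symm⟩
    · right
      exact Or.inr ⟨_, h, rfl⟩
  refine ⟨D, fun p hp => hp.1, hnull, ?_, ?_⟩
  · intro p hp
    rw [mem_closure_iff]
    intro o ho hpo
    by_contra hne
    have hpos := (ho.inter hopen).measure_pos volume ⟨p, hpo, hp⟩
    refine hpos.ne' (measure_mono_null ?_ hnull)
    rintro q ⟨hqo, hq⟩
    exact ⟨hq, fun hqD => hne ⟨q, hqo, hqD⟩⟩
  · rintro p ⟨hp, hc⟩
    exact ContinuousAt.comp (f := fun q : ℝ × ℝ => (q.1, -v q.1 q.2)) hc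
      (continuousAt_fst.prodMk (hca p hp).neg)
end

section
/- Cone determination: let H : ℝ → [0,∞) satisfy |H(p) − H(q)| ≤ |p − q| for all p,q ∈ ℝ and H(1−p) = H(p) for all p. Let c̃ : ℝ → [0,∞) be locally bounded measurable with essential envelopes c̃^*(x) := lim_{δ↓0} ess sup_{|y−x|≤δ} c̃(y) and c̃_*(x) := lim_{δ↓0} ess inf_{|y−x|≤δ} c̃(y). Fix z₀ = (x₀,t₀) ∈ ℝ × (0,∞) and K > 1 with K > sup of c̃^* over the backward cone C(z₀,K) := { (x,t) : 0 ≤ t ≤ t₀, |x−x₀| ≤ K(t₀−t) }. Assume that for every (x*,t*) ∈ C(z₀,K) there is a sign σ ∈ {−1,+1} such that for all M > 1, lim_{ρ↓0} sup over { y : |y−x*| ≤ K(t*−τ) ≤ Mρ } of [ c̃^*(y) − c̃_*(y−σρ) ] ≤ 0. Let v₁, v₂ be continuous on C(z₀,K), both nondecreasing and 1-Lipschitz in the x-variable, at least one of them Lipschitz on C(z₀,K), and such that on the cone: for every C¹ function φ with v₁ − φ having a local maximum at an interior point (x,t), φ_t(x,t) + c̃_*(x) H(φ_x(x,t)) ≤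 0; and for every C¹ function φ with v₂ − φ having a local minimum at an interior point (x,t), φ_t(x,t) + c̃^*(x) H(φ_x(x,t)) ≥ 0. Then max over C(z₀,K) of (v₁ − v₂) = max over C(z₀,K) ∩ {t = 0} of (v₁ − v₂). -/
open MeasureTheory

/-- The essential upper envelope `c̃^*(x) = lim_{δ↓0} ess sup_{|y−x|≤δ} c̃(y)`. -/
noncomputable def essUp (c : ℝ → ℝ) (x : ℝ) : ℝ :=
  ⨅ δ : {d : ℝ // 0 < d}, essSup c (volume.restrict (Metric.closedBall x δ.1))

/-- The essential lower envelope `c̃_*(x) = lim_{δ↓0} ess inf_{|y−x|≤δ} c̃(y)`. -/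
noncomputable def essLow (c : ℝ → ℝ) (x : ℝ) : ℝ :=
  ⨆ δ : {d : ℝ // 0 < d}, essInf c (volume.restrict (Metric.closedBall x δ.1))

/-- The backward cone with vertex `(x₀,t₀)` and slope `K`. -/
def cone (x₀ t₀ K : ℝ) : Set (ℝ × ℝ) :=
  {p : ℝ × ℝ | 0 ≤ p.2 ∧ p.2 ≤ t₀ ∧ |p.1 - x₀| ≤ K * (t₀ - p.2)}

open Filter Topology

lemma quad_hasFDerivAt (a α β : ℝ) (p : ℝ × ℝ) :
    HasFDerivAt (fun z : ℝ × ℝ => a * ((z.1 - α)^2 + (z.2 - β)^2))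
      ((2 * a * (p.1 - α)) • ContinuousLinearMap.fst ℝ ℝ ℝ +
        (2 * a * (p.2 - β)) • ContinuousLinearMap.snd ℝ ℝ ℝ) p := by
  have h1 : HasFDerivAt (fun z : ℝ × ℝ => z.1) (ContinuousLinearMap.fst ℝ ℝ ℝ) p := hasFDerivAt_fst
  have h2 : HasFDerivAt (fun z : ℝ × ℝ => z.2) (ContinuousLinearMap.snd ℝ ℝ ℝ) p := hasFDerivAt_snd
  have := ((((h1.sub_const α).pow 2).add ((h2.sub_const β).pow 2)).const_mul a)
  refine this.congr_fderiv ?_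
  ext <;> simp <;> ring

lemma arith_core (L A b ρ X Y T e f : ℝ) (hL : 1 ≤ L) (hA : A = 16 * L) (hb : 0 < b) (hρ : 0 < ρ)
    (hX : |X| ≤ |Y| + ρ)
    (h : -ρ ≤ L * (|X| + |T|) - A / ρ * (Y^2 + T^2) - b / ρ * (e^2 + f^2)) :
    |Y| ≤ ρ / 2 ∧ |T| ≤ ρ ∧ b * (e^2 + f^2) ≤ 3 * L * ρ^2 := by
  have h' : A * (Y^2 + T^2) + b * (e^2 + f^2) ≤ ρ^2 + L * ρ * (|X| + |T|) := by
    have h3 : A / ρ * (Y^2 + T^2) + b / ρ * (e^2 + f^2) ≤ ρ + L * (|X| + |T|) := by linarith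
    have h4 := mul_le_mul_of_nonneg_left h3 hρ.le
    have h5 : ρ * (A / ρ * (Y^2 + T^2) + b / ρ * (e^2 + f^2)) = A * (Y^2 + T^2) + b * (e^2 + f^2) := by
      field_simp
    rw [h5] at h4
    linarith
  have hbe : 0 ≤ b * (e^2 + f^2) := by positivity
  rw [← sq_abs Y, ← sq_abs T, hA] at h'
  have hY := abs_nonneg Y
  have hT := abs_nonneg T
  generalize |Y| = y at *
  generalize |T| = τ at *
  have hLρ : 0 ≤ L * ρ := by positivity
  have h6 : 16 * L * (y^2 + τ^2) + b * (e^2 + f^2) ≤ L * (2 * ρ^2 + ρ * y + ρ * τ) := by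
    nlinarith [mul_le_mul_of_nonneg_left hX hLρ, mul_nonneg (sub_nonneg.2 hL) (sq_nonneg ρ)]
  have h7 : 16 * (y^2 + τ^2) ≤ (2 * ρ^2 + ρ * y + ρ * τ) := by
    have : L * (16 * (y^2 + τ^2)) ≤ L * (2 * ρ^2 + ρ * y + ρ * τ) := by linarith
    exact le_of_mul_le_mul_left this (by linarith)
  refine ⟨?_, ?_, ?_⟩
  · nlinarith [sq_nonneg (8 * τ - ρ), sq_nonneg (y - ρ/2)]
  · nlinarith [sq_nonneg (8 * y - ρ), sq_nonneg (τ - ρ)]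
  · have : L * (2 * ρ^2 + ρ * y + ρ * τ - 16 * (y^2 + τ^2)) ≤ L * (3 * ρ^2) := by
      apply mul_le_mul_of_nonneg_left _ (by linarith)
      nlinarith [sq_nonneg (8 * y - ρ), sq_nonneg (8 * τ - ρ)]
    linarith

set_option maxHeartbeats 2000000 in
theorem core (H : ℝ → ℝ) (hHpos : ∀ p : ℝ, 0 ≤ H p)
    (hHlip : ∀ p q : ℝ, |H p - H q| ≤ |p - q|)
    (up low : ℝ → ℝ) (C : Set (ℝ × ℝ)) (hC : IsCompact C) (K : ℝ) (hK : 0 < K)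
    (hlow : ∀ p ∈ C, 0 ≤ low p.1 ∧ low p.1 ≤ K)
    (xs ts : ℝ) (hz : (xs, ts) ∈ interior C)
    (σ : ℝ) (hσ : σ = 1 ∨ σ = -1)
    (hmono : ∀ M : ℝ, 1 < M → ∀ ε : ℝ, 0 < ε → ∀ᶠ ρ in 𝓝[>] (0:ℝ),
      ∀ y, |y - xs| ≤ M * ρ → up y - low (y - σ * ρ) ≤ ε)
    (v₁ v₂ g : ℝ × ℝ → ℝ)
    (hcont1 : ContinuousOn v₁ C) (hcont2 : ContinuousOn v₂ C) (hg : ContDiff ℝ 1 g)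
    (hx2 : ∀ p q : ℝ × ℝ, p ∈ C → q ∈ C → p.2 = q.2 → |v₂ p - v₂ q| ≤ |p.1 - q.1|)
    (L : ℝ) (hL1 : 1 ≤ L)
    (hL : ∀ z ∈ C, ∀ z' ∈ C, v₁ z - g z - v₂ z' ≤
      v₁ (xs, ts) - g (xs, ts) - v₂ (xs, ts) + L * (|z.1 - z'.1| + |z.2 - z'.2|))
    (η : ℝ) (hη : 0 < η)
    (hgd : ∀ p, η + K * |fderiv ℝ g p (1, 0)| ≤ fderiv ℝ g p (0, 1))
    (hsub : ∀ φ : ℝ × ℝ → ℝ, ContDiff ℝ 1 φ → ∀ p ∈ interior C,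
      IsLocalMaxOn (fun q => v₁ q - φ q) C p →
      fderiv ℝ φ p (0, 1) + low p.1 * H (fderiv ℝ φ p (1, 0)) ≤ 0)
    (hsuper : ∀ φ : ℝ × ℝ → ℝ, ContDiff ℝ 1 φ → ∀ p ∈ interior C,
      IsLocalMinOn (fun q => v₂ q - φ q) C p →
      0 ≤ fderiv ℝ φ p (0, 1) + up p.1 * H (fderiv ℝ φ p (1, 0))) : False := by
  obtain ⟨r, hr, hball⟩ : ∃ r > 0, ∀ a b : ℝ, |a - xs| < r → |b - ts| < r → (a, b) ∈ interior C := by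
    obtain ⟨r, hr, h⟩ := Metric.isOpen_iff.1 isOpen_interior _ hz
    refine ⟨r, hr, fun a b ha hb => h ?_⟩
    rw [Metric.mem_ball, Prod.dist_eq, Real.dist_eq, Real.dist_eq]
    exact max_lt ha hb
  set β : ℝ := η / (8 * (1 + K)) with hβ
  have hβ0 : 0 < β := by positivity
  set b : ℝ := β^2 / (3 * L) with hb
  have hb0 : 0 < b := by positivity
  have hbL : b * (3 * L) = β^2 := by rw [hb]; field_simp
  set A : ℝ := 16 * L with hA
  set Z : ℝ := β / b with hZ
  have hZ0 : 0 < Z := by positivity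
  have hZb : Z * b = β := by rw [hZ]; field_simp
  set ε : ℝ := η / (4 * (H 0 + 16 * L)) with hε
  have hden : 0 < H 0 + 16 * L := by have := hHpos 0; linarith
  have hε0 : 0 < ε := by positivity
  have hεm : ε * (H 0 + 16 * L) = η / 4 := by rw [hε]; field_simp
  -- choose radius
  have hev := hmono (2 * Z + 3) (by linarith) ε hε0
  obtain ⟨ρ₀, hρ₀, hm⟩ : ∃ ρ₀ > 0, ∀ ρ, 0 < ρ → ρ < ρ₀ →
      ∀ y, |y - xs| ≤ (2 * Z + 3) * ρ → up y - low (y - σ * ρ) ≤ ε := by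
    rw [eventually_nhdsWithin_iff, Metric.eventually_nhds_iff] at hev
    obtain ⟨d, hd, h⟩ := hev
    refine ⟨d, hd, fun ρ h0 h1 => h ?_ h0⟩
    rw [Real.dist_eq, sub_zero, abs_of_pos h0]; exact h1
  obtain ⟨ρ, hρ, hρ1, hρ2⟩ : ∃ ρ > 0, 2 * ρ < ρ₀ ∧ (Z + 2) * ρ < r := by
    refine ⟨min (ρ₀ / 4) (r / (2 * (Z + 2))), by positivity, ?_, ?_⟩
    · have := min_le_left (ρ₀ / 4) (r / (2 * (Z + 2))); linarith
    · have := min_le_right (ρ₀ / 4) (r / (2 * (Z + 2)))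
      calc _ ≤ (Z + 2) * (r / (2 * (Z + 2))) := by gcongr
        _ = r / 2 := by field_simp
        _ < r := by linarith
  have hσabs : |σ * ρ| = ρ := by rcases hσ with rfl | rfl <;> simp [abs_of_pos hρ]
  have hσ2 : σ * σ = 1 := by rcases hσ with rfl | rfl <;> norm_num
  have hzC : (xs, ts) ∈ C := interior_subset hz
  have hρr : ρ < r := by nlinarith
  have hz2C : (xs + σ * ρ, ts) ∈ C := interior_subset (hball _ _ (by simpa [hσabs] using hρr) (by simpa using hr))
  -- doubled functional
  let Φ : (ℝ × ℝ) × (ℝ × ℝ) → ℝ := fun w => v₁ w.1 - v₂ w.2 - g w.1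
    - A / ρ * ((w.1.1 - w.2.1 + σ * ρ)^2 + (w.1.2 - w.2.2)^2)
    - b / ρ * ((w.1.1 - xs)^2 + (w.1.2 - ts)^2)
  have hΦ : ContinuousOn Φ (C ×ˢ C) := by
    have c1 : ContinuousOn (fun w : (ℝ × ℝ) × (ℝ × ℝ) => v₁ w.1) (C ×ˢ C) :=
      hcont1.comp continuousOn_fst (fun w hw => hw.1)
    have c2 : ContinuousOn (fun w : (ℝ × ℝ) × (ℝ × ℝ) => v₂ w.2) (C ×ˢ C) :=
      hcont2.comp continuousOn_snd (fun w hw => hw.2)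
    have c3 : Continuous g := hg.continuous
    have c4 : Continuous (fun w : (ℝ × ℝ) × (ℝ × ℝ) => g w.1) := by fun_prop
    have c5 : Continuous (fun w : (ℝ × ℝ) × (ℝ × ℝ) => A / ρ * ((w.1.1 - w.2.1 + σ * ρ)^2 + (w.1.2 - w.2.2)^2)) := by fun_prop
    have c6 : Continuous (fun w : (ℝ × ℝ) × (ℝ × ℝ) => b / ρ * ((w.1.1 - xs)^2 + (w.1.2 - ts)^2)) := by fun_prop
    exact (((c1.sub c2).sub c4.continuousOn).sub c5.continuousOn).sub c6.continuousOn
  obtain ⟨⟨⟨x, t⟩, ⟨y, s⟩⟩, ⟨hxC, hyC⟩, hmax⟩ := (hC.prod hC).exists_isMaxOn ⟨((xs, ts), (xs, ts)), hzC, hzC⟩ hΦ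
  simp only at hxC hyC
  have hcmp := hmax (show ((xs, ts), (xs + σ * ρ, ts)) ∈ C ×ˢ C from ⟨hzC, hz2C⟩)
  have hv2 := hx2 _ _ hz2C hzC rfl
  simp only [add_sub_cancel_left, hσabs] at hv2
  have hLL := hL _ hxC _ hyC
  simp only [Set.mem_ofPred_eq, Φ] at hcmp
  simp only at hLL
  have hq0 : (xs - (xs + σ * ρ) + σ * ρ) = 0 := by ring
  rw [hq0] at hcmp
  simp only [sub_self] at hcmp
  have hX : |x - y| ≤ |x - y + σ * ρ| + ρ := by
    have := abs_sub (x - y + σ * ρ) (σ * ρ)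
    rw [hσabs] at this
    simpa using this
  obtain ⟨hY, hT, hE⟩ := arith_core L A b ρ (x - y) (x - y + σ * ρ) (t - s) (x - xs) (t - ts)
    hL1 hA hb0 hρ hX (by
      have := (abs_le.1 hv2).2
      norm_num at hcmp
      linarith)
  have hE2 : (x - xs)^2 + (t - ts)^2 ≤ (Z * ρ)^2 := by
    have h1 : b * (b * ((x - xs)^2 + (t - ts)^2)) ≤ b * (3 * L * ρ^2) := by gcongr
    have h2 : b * (3 * L * ρ^2) = b * (b * (Z * ρ)^2) := by
      calc _ = (b * (3 * L)) * ρ^2 := by ring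
        _ = (Z * b)^2 * ρ^2 := by rw [hbL, hZb]
        _ = _ := by ring
    rw [h2] at h1
    exact le_of_mul_le_mul_left (le_of_mul_le_mul_left h1 hb0) hb0
  have hex : |x - xs| ≤ Z * ρ := abs_le_of_sq_le_sq (by nlinarith [sq_nonneg (t - ts)]) (by positivity)
  have het : |t - ts| ≤ Z * ρ := abs_le_of_sq_le_sq (by nlinarith [sq_nonneg (x - xs)]) (by positivity)
  have hey : |y - xs| ≤ Z * ρ + 3 / 2 * ρ := by
    have h1 := abs_sub_le y x xs
    rw [abs_sub_comm y x] at h1; linarith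
  have hes : |s - ts| ≤ Z * ρ + ρ := by
    have h1 := abs_sub_le s t ts
    rw [abs_sub_comm s t] at h1; linarith
  have hxI : (x, t) ∈ interior C := hball _ _ (by linarith) (by linarith)
  have hyI : (y, s) ∈ interior C := hball _ _ (by linarith) (by linarith)
  -- sub test
  have hs1 := hsub (fun z => g z + A / ρ * ((z.1 - (y - σ * ρ))^2 + (z.2 - s)^2)
      + b / ρ * ((z.1 - xs)^2 + (z.2 - ts)^2)) (by fun_prop) (x, t) hxI (by
      apply IsMaxOn.localize
      intro z hzz
      have h := hmax (show (z, (y, s)) ∈ C ×ˢ C from ⟨hzz, hyC⟩)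
      simp only [Set.mem_ofPred_eq, Φ] at h ⊢
      rw [show z.1 - (y - σ * ρ) = z.1 - y + σ * ρ by ring, show x - (y - σ * ρ) = x - y + σ * ρ by ring]
      linarith)
  have hs2 := hsuper (fun z => (-(A / ρ)) * ((z.1 - (x + σ * ρ))^2 + (z.2 - t)^2)) (by fun_prop) (y, s) hyI (by
      apply IsMinOn.localize
      intro z hzz
      have h := hmax (show ((x, t), z) ∈ C ×ˢ C from ⟨hxC, hzz⟩)
      simp only [Set.mem_ofPred_eq, Φ] at h ⊢
      rw [show z.1 - (x + σ * ρ) = -(x - z.1 + σ * ρ) by ring, show y - (x + σ * ρ) = -(x - y + σ * ρ) by ring,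
        show z.2 - t = -(t - z.2) by ring, show s - t = -(t - s) by ring]
      simp only [neg_sq]
      linarith)
  rw [(quad_hasFDerivAt _ _ _ _).fderiv] at hs2
  have hd : HasFDerivAt (fun z : ℝ × ℝ => g z + A / ρ * ((z.1 - (y - σ * ρ))^2 + (z.2 - s)^2)
      + b / ρ * ((z.1 - xs)^2 + (z.2 - ts)^2)) _ (x, t) :=
    ((hg.differentiable (by norm_num)) (x, t)).hasFDerivAt.add
      (quad_hasFDerivAt (A / ρ) (y - σ * ρ) s (x, t)) |>.add (quad_hasFDerivAt (b / ρ) xs ts (x, t))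
  rw [hd.fderiv] at hs1
  simp at hs1 hs2
  have hgdz := hgd (x, t)
  generalize fderiv ℝ g (x, t) (1, 0) = gx at *
  generalize fderiv ℝ g (x, t) (0, 1) = gt at *
  set q := 2 * (A / ρ) * (x - (y - σ * ρ)) with hq
  have hq' : -(2 * (A / ρ) * (y - (x + σ * ρ))) = q := by rw [hq]; ring
  have hlx := hlow _ hxC
  simp only at hlx
  have hqb : |q| ≤ 16 * L := by
    rw [hq, show x - (y - σ * ρ) = x - y + σ * ρ by ring, abs_mul, abs_of_pos (by positivity : 0 < 2 * (A / ρ))]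
    calc _ ≤ 2 * (A / ρ) * (ρ / 2) := by gcongr
      _ = A := by field_simp
      _ ≤ _ := le_rfl
  have hHq : H q ≤ H 0 + 16 * L := by
    have h1 := (abs_le.1 (hHlip q 0)).2
    rw [sub_zero] at h1; linarith
  have hbnd : ∀ e : ℝ, |e| ≤ Z * ρ → |2 * (b / ρ) * e| ≤ 2 * β := by
    intro e he
    rw [abs_mul, abs_of_pos (by positivity : 0 < 2 * (b / ρ))]
    calc _ ≤ 2 * (b / ρ) * (Z * ρ) := by gcongr
      _ = 2 * (Z * b) := by field_simp
      _ = _ := by rw [hZb]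
  have e1 := hbnd _ hex
  have e2 := hbnd _ het
  set ex := 2 * (b / ρ) * (x - xs)
  set et := 2 * (b / ρ) * (t - ts)
  -- coefficient comparison
  have hco : up y - low x ≤ ε := by
    have hY' := abs_le.1 hY
    have hp : ρ / 2 ≤ σ * (y - x) ∧ σ * (y - x) ≤ 2 * ρ := by
      rcases hσ with rfl | rfl <;> constructor <;> linarith [hY'.1, hY'.2]
    have := hm (σ * (y - x)) (by linarith [hp.1]) (by linarith [hp.2]) y (by
      nlinarith [hp.1, hey])
    rwa [← mul_assoc, hσ2, one_mul, sub_sub_cancel] at this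
  have hHd : H q - (|gx| + 2 * β) ≤ H (gx + q + ex) := by
    have h1 := (abs_le.1 (hHlip q (gx + q + ex))).2
    have h2 : |q - (gx + q + ex)| ≤ |gx| + |ex| := by
      rw [show q - (gx + q + ex) = -(gx + ex) by ring, abs_neg]; exact abs_add_le _ _
    linarith
  have hs2' : 0 ≤ 2 * (A / ρ) * (t - s) + up y * H q := by
    rw [← hq']
    linarith
  have k1 : low x * (H q - (|gx| + 2 * β)) ≤ low x * H (gx + q + ex) :=
    mul_le_mul_of_nonneg_left hHd hlx.1
  have k2 : low x * (|gx| + 2 * β) ≤ K * (|gx| + 2 * β) :=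
    mul_le_mul_of_nonneg_right hlx.2 (by positivity)
  have k3 : (up y - low x) * H q ≤ ε * (H 0 + 16 * L) :=
    (mul_le_mul_of_nonneg_right hco (hHpos q)).trans (mul_le_mul_of_nonneg_left hHq hε0.le)
  have k4 : 2 * β * (1 + K) = η / 4 := by rw [hβ]; field_simp; norm_num
  have := (abs_le.1 e2).1
  nlinarith

lemma env_bdd (ct : ℝ → ℝ) (hloc : ∀ K : Set ℝ, IsCompact K → ∃ M : ℝ, ∀ x ∈ K, |ct x| ≤ M) (x δ : ℝ) :
    IsBoundedUnder (· ≤ ·) (ae (volume.restrict (Metric.closedBall x δ))) ct ∧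
    IsBoundedUnder (· ≥ ·) (ae (volume.restrict (Metric.closedBall x δ))) ct := by
  obtain ⟨M, hM⟩ := hloc _ (isCompact_closedBall x δ)
  have h : ∀ᵐ y ∂(volume.restrict (Metric.closedBall x δ)), |ct y| ≤ M := by
    filter_upwards [ae_restrict_mem measurableSet_closedBall] with y hy using hM y hy
  constructor
  · exact ⟨M, by rw [eventually_map]; filter_upwards [h] with y hy using (abs_le.1 hy).2⟩
  · exact ⟨-M, by rw [eventually_map]; filter_upwards [h] with y hy using (abs_le.1 hy).1⟩

lemma ball_neBot (x δ : ℝ) (hδ : 0 < δ) : (ae (volume.restrict (Metric.closedBall x δ))).NeBot := by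
  rw [ae_neBot]
  intro h
  rw [Measure.restrict_eq_zero] at h
  exact (Metric.measure_closedBall_pos volume x hδ).ne' h

lemma essInf_le_essSup_ball (ct : ℝ → ℝ)
    (hloc : ∀ K : Set ℝ, IsCompact K → ∃ M : ℝ, ∀ x ∈ K, |ct x| ≤ M) (x δ₁ δ₂ : ℝ)
    (h₁ : 0 < δ₁) (h₂ : 0 < δ₂) :
    essInf ct (volume.restrict (Metric.closedBall x δ₁)) ≤
      essSup ct (volume.restrict (Metric.closedBall x δ₂)) := by
  have a1 := ae_essInf_le (env_bdd ct hloc x δ₁).2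
  have a2 := ae_le_essSup (env_bdd ct hloc x δ₂).1
  have hm : 0 < min δ₁ δ₂ := lt_min h₁ h₂
  have a1' := ae_restrict_of_ae_restrict_of_subset
    (Metric.closedBall_subset_closedBall (min_le_left δ₁ δ₂) (x := x)) a1
  have a2' := ae_restrict_of_ae_restrict_of_subset
    (Metric.closedBall_subset_closedBall (min_le_right δ₁ δ₂) (x := x)) a2
  have := ball_neBot x _ hm
  obtain ⟨y, hy1, hy2⟩ := (a1'.and a2').exists
  exact hy1.trans hy2

lemma essInf_nonneg_ball (ct : ℝ → ℝ) (hpos : ∀ x, 0 ≤ ct x)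
    (hloc : ∀ K : Set ℝ, IsCompact K → ∃ M : ℝ, ∀ x ∈ K, |ct x| ≤ M) (x δ : ℝ)
    (h : 0 < δ) : 0 ≤ essInf ct (volume.restrict (Metric.closedBall x δ)) := by
  have := ball_neBot x _ h
  exact le_essInf_of_ae_le 0 (Eventually.of_forall hpos) (env_bdd ct hloc x δ).1.isCoboundedUnder_ge

lemma essLow_nonneg (ct : ℝ → ℝ) (hpos : ∀ x, 0 ≤ ct x)
    (hloc : ∀ K : Set ℝ, IsCompact K → ∃ M : ℝ, ∀ x ∈ K, |ct x| ≤ M) (x : ℝ) : 0 ≤ essLow ct x := by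
  have hb : BddAbove (Set.range fun δ : {d : ℝ // 0 < d} =>
      essInf ct (volume.restrict (Metric.closedBall x δ.1))) := by
    refine ⟨essSup ct (volume.restrict (Metric.closedBall x 1)), ?_⟩
    rintro _ ⟨δ, rfl⟩
    exact essInf_le_essSup_ball ct hloc x _ _ δ.2 one_pos
  exact le_ciSup_of_le hb ⟨1, one_pos⟩ (essInf_nonneg_ball ct hpos hloc x 1 one_pos)

lemma essLow_le_essUp (ct : ℝ → ℝ)
    (hloc : ∀ K : Set ℝ, IsCompact K → ∃ M : ℝ, ∀ x ∈ K, |ct x| ≤ M) (x : ℝ) :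
    essLow ct x ≤ essUp ct x := by
  have : Nonempty {d : ℝ // 0 < d} := ⟨⟨1, one_pos⟩⟩
  exact ciSup_le fun δ₁ => le_ciInf fun δ₂ => essInf_le_essSup_ball ct hloc x _ _ δ₁.2 δ₂.2

lemma essUp_le (ct : ℝ → ℝ)
    (hloc : ∀ K : Set ℝ, IsCompact K → ∃ M : ℝ, ∀ x ∈ K, |ct x| ≤ M) (x M : ℝ)
    (hM : ∀ y ∈ Metric.closedBall x 1, ct y ≤ M) : essUp ct x ≤ M := by
  have hb : BddBelow (Set.range fun δ : {d : ℝ // 0 < d} =>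
      essSup ct (volume.restrict (Metric.closedBall x δ.1))) := by
    refine ⟨essInf ct (volume.restrict (Metric.closedBall x 1)), ?_⟩
    rintro _ ⟨δ, rfl⟩
    exact essInf_le_essSup_ball ct hloc x _ _ one_pos δ.2
  refine ciInf_le_of_le hb ⟨1, one_pos⟩ ?_
  have := ball_neBot x 1 one_pos
  refine essSup_le_of_ae_le M ?_ (env_bdd ct hloc x 1).2.isCoboundedUnder_le
  filter_upwards [ae_restrict_mem measurableSet_closedBall] with y hy using hM y hy

lemma mono_of_limsup (ct : ℝ → ℝ) (hpos : ∀ x, 0 ≤ ct x)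
    (hloc : ∀ K : Set ℝ, IsCompact K → ∃ M : ℝ, ∀ x ∈ K, |ct x| ≤ M) (xs σ M : ℝ) (hM : 1 < M)
    (h : Filter.limsup (fun ρ : ℝ =>
            sSup ((fun y => essUp ct y - essLow ct (y - σ * ρ)) ''
              Metric.closedBall xs (M * ρ)))
          (nhdsWithin 0 (Set.Ioi 0)) ≤ 0) (ε : ℝ) (hε : 0 < ε) :
    ∀ᶠ ρ in 𝓝[>] (0:ℝ), ∀ y, |y - xs| ≤ M * ρ → essUp ct y - essLow ct (y - σ * ρ) ≤ ε := by
  obtain ⟨B, hB⟩ := hloc _ (isCompact_closedBall xs 2)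
  have hup : ∀ y, |y - xs| ≤ 1 → essUp ct y ≤ B := by
    intro y hy
    refine essUp_le ct hloc y B fun z hz => (le_abs_self _).trans (hB z ?_)
    rw [Metric.mem_closedBall, Real.dist_eq] at hz ⊢
    have := abs_sub_le z y xs
    linarith
  have hsmall : ∀ᶠ ρ in 𝓝[>] (0:ℝ), 0 < ρ ∧ M * ρ ≤ 1 := by
    have h1 : ∀ᶠ ρ in 𝓝[>] (0:ℝ), ρ ∈ Set.Ioo (0:ℝ) (1 / M) := Ioo_mem_nhdsGT (by positivity)
    filter_upwards [h1] with ρ hρ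
    refine ⟨hρ.1, ?_⟩
    have := mul_le_mul_of_nonneg_left hρ.2.le (by linarith : (0:ℝ) ≤ M)
    rwa [mul_one_div_cancel (by linarith)] at this
  have hbd : ∀ ρ, M * ρ ≤ 1 → ∀ a ∈ ((fun y => essUp ct y - essLow ct (y - σ * ρ)) ''
              Metric.closedBall xs (M * ρ)), a ≤ B := by
    rintro ρ hρ _ ⟨y, hy, rfl⟩
    rw [Metric.mem_closedBall, Real.dist_eq] at hy
    have h1 := hup y (by linarith)
    have h2 := essLow_nonneg ct hpos hloc (y - σ * ρ)
    simp only; linarith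
  have hev := eventually_lt_of_limsup_lt (lt_of_le_of_lt h hε) (by
    refine ⟨B, ?_⟩
    rw [eventually_map]
    filter_upwards [hsmall] with ρ hρ
    refine csSup_le ?_ (hbd ρ hρ.2)
    exact (Metric.nonempty_closedBall.2 (by nlinarith [hρ.1])).image _)
  filter_upwards [hev, hsmall] with ρ h1 h2 y hy
  refine (le_csSup ⟨B, hbd ρ h2.2⟩ ⟨y, ?_, rfl⟩).trans h1.le
  rw [Metric.mem_closedBall, Real.dist_eq]; exact hy

lemma cone_compact (x₀ t₀ K : ℝ) (hK : 0 < K) : IsCompact (cone x₀ t₀ K) := by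
  have hcl : IsClosed (cone x₀ t₀ K) := by
    unfold cone
    have a1 : IsClosed {p : ℝ × ℝ | 0 ≤ p.2} := isClosed_le (by fun_prop) (by fun_prop)
    have a2 : IsClosed {p : ℝ × ℝ | p.2 ≤ t₀} := isClosed_le (by fun_prop) (by fun_prop)
    have a3 : IsClosed {p : ℝ × ℝ | |p.1 - x₀| ≤ K * (t₀ - p.2)} := isClosed_le (by fun_prop) (by fun_prop)
    exact a1.inter (a2.inter a3)
  refine (isCompact_Icc (a := (x₀ - K * t₀, (0:ℝ))) (b := (x₀ + K * t₀, t₀))).of_isClosed_subset hcl ?_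
  rintro ⟨x, t⟩ ⟨h1, h2, h3⟩
  simp only at h1 h2 h3
  have h4 := abs_le.1 h3
  have h5 : 0 ≤ K * t := by positivity
  refine ⟨⟨?_, h1⟩, ⟨?_, h2⟩⟩ <;> simp only <;> nlinarith [h4.1, h4.2]

lemma cone_interior (x₀ t₀ K x t : ℝ) (hK : 0 < K) (h1 : 0 < t) (h2 : |x - x₀| < K * (t₀ - t)) :
    (x, t) ∈ interior (cone x₀ t₀ K) := by
  have : IsOpen {p : ℝ × ℝ | 0 < p.2 ∧ |p.1 - x₀| < K * (t₀ - p.2)} := by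
    have a1 : IsOpen {p : ℝ × ℝ | 0 < p.2} := isOpen_lt (by fun_prop) (by fun_prop)
    have a3 : IsOpen {p : ℝ × ℝ | |p.1 - x₀| < K * (t₀ - p.2)} := isOpen_lt (by fun_prop) (by fun_prop)
    exact a1.inter a3
  refine interior_maximal ?_ this ⟨h1, h2⟩
  rintro ⟨a, b⟩ ⟨h3, h4⟩
  simp only at h3 h4
  refine ⟨h3.le, ?_, h4.le⟩
  simp only
  have := (abs_nonneg _).trans_lt h4
  by_contra hc
  push Not at hc
  nlinarith

lemma barrier_hasFDerivAt (x₀ t₀ K N δ η : ℝ) (p : ℝ × ℝ) :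
    HasFDerivAt (fun z : ℝ × ℝ => η * z.2 + (Real.exp (N * (z.1 - x₀ - K * (t₀ - z.2) + δ)) +
      Real.exp (N * (-(z.1 - x₀) - K * (t₀ - z.2) + δ))))
      ((N * (Real.exp (N * (p.1 - x₀ - K * (t₀ - p.2) + δ)) -
        Real.exp (N * (-(p.1 - x₀) - K * (t₀ - p.2) + δ)))) • ContinuousLinearMap.fst ℝ ℝ ℝ +
       (η + K * (N * (Real.exp (N * (p.1 - x₀ - K * (t₀ - p.2) + δ)) +
        Real.exp (N * (-(p.1 - x₀) - K * (t₀ - p.2) + δ))))) • ContinuousLinearMap.snd ℝ ℝ ℝ) p := by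
  have h1 : HasFDerivAt (fun z : ℝ × ℝ => z.1) (ContinuousLinearMap.fst ℝ ℝ ℝ) p := hasFDerivAt_fst
  have h2 : HasFDerivAt (fun z : ℝ × ℝ => z.2) (ContinuousLinearMap.snd ℝ ℝ ℝ) p := hasFDerivAt_snd
  have h3 := (h2.const_sub t₀).const_mul K
  have h4 := ((((h1.sub_const x₀).sub h3).add_const δ).const_mul N).exp
  have h5 := (((((h1.sub_const x₀).neg).sub h3).add_const δ).const_mul N).exp
  refine ((h2.const_mul η).add (h4.add h5)).congr_fderiv ?_
  ext <;> simp <;> ring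

/-- Cone determination for `v_t + c̃(x)H(v_x) = 0` with a discontinuous spatial
coefficient: under the dominance and monotonicity conditions on `c̃` along the cone, the
maximum of `v₁ − v₂` over the cone is attained on its base `{t = 0}`. -/
theorem stmt_17 (H : ℝ → ℝ)
    (hHpos : ∀ p : ℝ, 0 ≤ H p)
    (hHlip : ∀ p q : ℝ, |H p - H q| ≤ |p - q|)
    (hHsym : ∀ p : ℝ, H (1 - p) = H p)
    (ct : ℝ → ℝ) (hmeas : Measurable ct) (hctpos : ∀ x, 0 ≤ ct x)
    (hloc : ∀ K : Set ℝ, IsCompact K → ∃ M : ℝ, ∀ x ∈ K, |ct x| ≤ M)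
    (x₀ t₀ Kc : ℝ) (ht₀ : 0 < t₀) (hKc : 1 < Kc)
    (hdom : ∃ M' : ℝ, (∀ p ∈ cone x₀ t₀ Kc, essUp ct p.1 ≤ M') ∧ M' < Kc)
    (hmonocond : ∀ p ∈ cone x₀ t₀ Kc, ∃ σ : ℝ, (σ = 1 ∨ σ = -1) ∧
      ∀ M : ℝ, 1 < M →
        Filter.limsup (fun ρ : ℝ =>
            sSup ((fun y => essUp ct y - essLow ct (y - σ * ρ)) ''
              Metric.closedBall p.1 (M * ρ)))
          (nhdsWithin 0 (Set.Ioi 0)) ≤ 0)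
    (v₁ v₂ : ℝ × ℝ → ℝ)
    (hcont1 : ContinuousOn v₁ (cone x₀ t₀ Kc))
    (hcont2 : ContinuousOn v₂ (cone x₀ t₀ Kc))
    (hx1 : ∀ p q : ℝ × ℝ, p ∈ cone x₀ t₀ Kc → q ∈ cone x₀ t₀ Kc → p.2 = q.2 →
      p.1 ≤ q.1 → v₁ p ≤ v₁ q ∧ v₁ q - v₁ p ≤ q.1 - p.1)
    (hx2 : ∀ p q : ℝ × ℝ, p ∈ cone x₀ t₀ Kc → q ∈ cone x₀ t₀ Kc → p.2 = q.2 →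
      p.1 ≤ q.1 → v₂ p ≤ v₂ q ∧ v₂ q - v₂ p ≤ q.1 - p.1)
    (hlipone : ∃ L : NNReal, LipschitzOnWith L v₁ (cone x₀ t₀ Kc) ∨
      LipschitzOnWith L v₂ (cone x₀ t₀ Kc))
    (hsub : ∀ φ : ℝ × ℝ → ℝ, ContDiff ℝ 1 φ → ∀ p ∈ interior (cone x₀ t₀ Kc),
      IsLocalMaxOn (fun q => v₁ q - φ q) (cone x₀ t₀ Kc) p →
      fderiv ℝ φ p (0, 1) + essLow ct p.1 * H (fderiv ℝ φ p (1, 0)) ≤ 0)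
    (hsuper : ∀ φ : ℝ × ℝ → ℝ, ContDiff ℝ 1 φ → ∀ p ∈ interior (cone x₀ t₀ Kc),
      IsLocalMinOn (fun q => v₂ q - φ q) (cone x₀ t₀ Kc) p →
      0 ≤ fderiv ℝ φ p (0, 1) + essUp ct p.1 * H (fderiv ℝ φ p (1, 0))) :
    sSup ((fun p => v₁ p - v₂ p) '' cone x₀ t₀ Kc) =
      sSup ((fun p => v₁ p - v₂ p) '' (cone x₀ t₀ Kc ∩ {p : ℝ × ℝ | p.2 = 0})) := by
  obtain ⟨M', hM', hM'K⟩ := hdom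
  have hK0 : 0 < Kc := by linarith
  have hC := cone_compact x₀ t₀ Kc hK0
  have hwc : ContinuousOn (fun p => v₁ p - v₂ p) (cone x₀ t₀ Kc) := hcont1.sub hcont2
  have hbase : (x₀, (0:ℝ)) ∈ cone x₀ t₀ Kc := by
    refine ⟨le_rfl, ht₀.le, ?_⟩
    simp only [sub_self, abs_zero, sub_zero]; positivity
  have hbdd : BddAbove ((fun p => v₁ p - v₂ p) '' cone x₀ t₀ Kc) := (hC.image_of_continuousOn hwc).bddAbove
  have hbdd0 : BddAbove ((fun p => v₁ p - v₂ p) '' (cone x₀ t₀ Kc ∩ {p : ℝ × ℝ | p.2 = 0})) :=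
    hbdd.mono (Set.image_mono Set.inter_subset_left)
  refine le_antisymm ?_ (csSup_le_csSup hbdd ⟨_, ⟨(x₀, 0), ⟨hbase, rfl⟩, rfl⟩⟩ (Set.image_mono Set.inter_subset_left))
  set m := sSup ((fun p => v₁ p - v₂ p) '' cone x₀ t₀ Kc) with hm
  set m₀ := sSup ((fun p => v₁ p - v₂ p) '' (cone x₀ t₀ Kc ∩ {p : ℝ × ℝ | p.2 = 0})) with hm₀
  have hle : ∀ p ∈ cone x₀ t₀ Kc, v₁ p - v₂ p ≤ m := fun p hp => le_csSup hbdd ⟨p, hp, rfl⟩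
  have hle0 : ∀ p ∈ cone x₀ t₀ Kc, p.2 = 0 → v₁ p - v₂ p ≤ m₀ :=
    fun p hp h0 => le_csSup hbdd0 ⟨p, ⟨hp, h0⟩, rfl⟩
  by_contra hlt
  push Not at hlt
  obtain ⟨_, ⟨⟨x1, t1⟩, hz1, rfl⟩, hw1⟩ := exists_lt_of_lt_csSup (Set.Nonempty.image _ ⟨(x₀, (0:ℝ)), hbase⟩) hlt
  simp only at hw1
  -- move into the interior
  obtain ⟨x2, t2, hz2, hgap, hw2⟩ : ∃ x2 t2, (x2, t2) ∈ cone x₀ t₀ Kc ∧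
      |x2 - x₀| < Kc * (t₀ - t2) ∧ m₀ < v₁ (x2, t2) - v₂ (x2, t2) := by
    obtain ⟨k1, k2, k3⟩ := hz1
    simp only at k1 k2 k3
    have hpath : ∀ θ ∈ Set.Ioc (0:ℝ) 1, |(x1 + θ * (x₀ - x1)) - x₀| < Kc * (t₀ - (1 - θ) * t1) ∧
        (x1 + θ * (x₀ - x1), (1 - θ) * t1) ∈ cone x₀ t₀ Kc := by
      rintro θ ⟨hθ, hθ1⟩
      have e : |(x1 + θ * (x₀ - x1)) - x₀| < Kc * (t₀ - (1 - θ) * t1) := by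
        rw [show (x1 + θ * (x₀ - x1)) - x₀ = (1 - θ) * (x1 - x₀) by ring, abs_mul,
          abs_of_nonneg (by linarith : 0 ≤ 1 - θ)]
        have := mul_le_mul_of_nonneg_left k3 (by linarith : 0 ≤ 1 - θ)
        have h3 : 0 < Kc * (θ * t₀) := by positivity
        nlinarith
      refine ⟨e, mul_nonneg (by linarith) k1, ?_, e.le⟩
      simp only
      nlinarith
    have hct : ContinuousWithinAt (fun θ : ℝ => v₁ (x1 + θ * (x₀ - x1), (1 - θ) * t1)
        - v₂ (x1 + θ * (x₀ - x1), (1 - θ) * t1)) (Set.Ioc 0 1) 0 := by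
      have hg0 : ContinuousWithinAt (fun θ : ℝ => (x1 + θ * (x₀ - x1), (1 - θ) * t1)) (Set.Ioc 0 1) 0 := by
        apply Continuous.continuousWithinAt; fun_prop
      refine ContinuousWithinAt.comp (t := cone x₀ t₀ Kc) (g := fun p => v₁ p - v₂ p)
        (f := fun θ : ℝ => (x1 + θ * (x₀ - x1), (1 - θ) * t1)) ?_ hg0 (fun θ hθ => (hpath θ hθ).2)
      have := hwc (x1, t1) ⟨k1, k2, k3⟩
      simpa using this
    have hev : ∀ᶠ θ in 𝓝[Set.Ioc (0:ℝ) 1] 0, m₀ < v₁ (x1 + θ * (x₀ - x1), (1 - θ) * t1)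
        - v₂ (x1 + θ * (x₀ - x1), (1 - θ) * t1) := by
      refine hct.eventually (lt_mem_nhds ?_)
      simpa using hw1
    have hnb : (𝓝[Set.Ioc (0:ℝ) 1] (0:ℝ)).NeBot := by
      rw [nhdsWithin_Ioc_eq_nhdsGT one_pos]; infer_instance
    obtain ⟨θ, hθ1, hθ2⟩ := (hev.and self_mem_nhdsWithin).exists
    exact ⟨_, _, (hpath θ hθ2).2, (hpath θ hθ2).1, hθ1⟩
  obtain ⟨δ, hδ, hδg⟩ : ∃ δ > 0, |x2 - x₀| = Kc * (t₀ - t2) - 2 * δ :=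
    ⟨(Kc * (t₀ - t2) - |x2 - x₀|) / 2, by linarith, by ring⟩
  obtain ⟨κ, hκ, hκw⟩ : ∃ κ > 0, v₁ (x2, t2) - v₂ (x2, t2) = m₀ + 3 * κ :=
    ⟨(v₁ (x2, t2) - v₂ (x2, t2) - m₀) / 3, by linarith, by ring⟩
  set η := κ / t₀ with hη
  have hη0 : 0 < η := by positivity
  have hηt : η * t₀ = κ := by rw [hη]; field_simp
  set N := (2 / κ + (m - m₀)) / δ with hN
  have hmm : 0 < m - m₀ := by linarith
  have hN0 : 0 < N := by positivity
  have hNδ : N * δ = 2 / κ + (m - m₀) := by rw [hN]; field_simp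
  have hexp : 2 / κ + (m - m₀) < Real.exp (N * δ) := by
    have := Real.add_one_le_exp (N * δ); linarith
  have hexpn : Real.exp (-(N * δ)) ≤ κ / 2 := by
    rw [Real.exp_neg, inv_le_comm₀ (Real.exp_pos _) (by positivity), inv_div]
    linarith
  let g : ℝ × ℝ → ℝ := fun z => η * z.2 + (Real.exp (N * (z.1 - x₀ - Kc * (t₀ - z.2) + δ)) +
      Real.exp (N * (-(z.1 - x₀) - Kc * (t₀ - z.2) + δ)))
  have hg : ContDiff ℝ 1 g := by
    simp only [g]; fun_prop
  have hgd : ∀ p, η + Kc * |fderiv ℝ g p (1, 0)| ≤ fderiv ℝ g p (0, 1) := by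
    intro p
    rw [(barrier_hasFDerivAt x₀ t₀ Kc N δ η p).fderiv]
    simp
    have ha := Real.exp_pos (N * (p.1 - x₀ - Kc * (t₀ - p.2) + δ))
    have hb := Real.exp_pos (N * (x₀ - p.1 - Kc * (t₀ - p.2) + δ))
    generalize Real.exp (N * (p.1 - x₀ - Kc * (t₀ - p.2) + δ)) = a at *
    generalize Real.exp (N * (x₀ - p.1 - Kc * (t₀ - p.2) + δ)) = b at *
    rw [abs_of_pos hN0]
    gcongr
    rw [abs_le]; constructor <;> linarith
  obtain ⟨⟨xs, ts⟩, hzC, hmax⟩ := hC.exists_isMaxOn ⟨_, hbase⟩ (hwc.sub hg.continuous.continuousOn)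
  have hmaxle : ∀ z ∈ cone x₀ t₀ Kc, v₁ z - v₂ z - g z ≤ v₁ (xs, ts) - v₂ (xs, ts) - g (xs, ts) :=
    fun z hz => hmax hz
  have hz2val : g (x2, t2) ≤ 2 * κ := by
    have h4 := abs_le.1 hδg.le
    have e1 : Real.exp (N * (x2 - x₀ - Kc * (t₀ - t2) + δ)) ≤ Real.exp (-(N * δ)) := by
      apply Real.exp_le_exp.2; rw [← mul_neg]; apply mul_le_mul_of_nonneg_left _ hN0.le; linarith [h4.2]
    have e2 : Real.exp (N * (-(x2 - x₀) - Kc * (t₀ - t2) + δ)) ≤ Real.exp (-(N * δ)) := by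
      apply Real.exp_le_exp.2; rw [← mul_neg]; apply mul_le_mul_of_nonneg_left _ hN0.le; linarith [h4.1]
    have e3 : η * t2 ≤ κ := by rw [← hηt]; exact mul_le_mul_of_nonneg_left hz2.2.1 hη0.le
    simp only [g]
    linarith
  have hWs : m₀ + κ ≤ v₁ (xs, ts) - v₂ (xs, ts) - g (xs, ts) := by
    have := hmaxle _ hz2; linarith
  have hts0 : 0 ≤ ts := hzC.1
  have hlat : |xs - x₀| ≤ Kc * (t₀ - ts) := hzC.2.2
  have pe1 := Real.exp_pos (N * (xs - x₀ - Kc * (t₀ - ts) + δ))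
  have pe2 := Real.exp_pos (N * (-(xs - x₀) - Kc * (t₀ - ts) + δ))
  have pe3 : 0 ≤ η * ts := by positivity
  have hgs : g (xs, ts) = η * ts + (Real.exp (N * (xs - x₀ - Kc * (t₀ - ts) + δ)) +
      Real.exp (N * (-(xs - x₀) - Kc * (t₀ - ts) + δ))) := rfl
  have hts : 0 < ts := by
    rcases hts0.lt_or_eq with h | h
    · exact h
    · have := hle0 _ hzC h.symm
      linarith
  have hlat' : |xs - x₀| < Kc * (t₀ - ts) := by
    refine lt_of_le_of_ne hlat fun he => ?_
    have h1 := hle _ hzC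
    have h2 : Real.exp (N * δ) ≤ g (xs, ts) := by
      rcases abs_choice (xs - x₀) with h | h
      · have : N * (xs - x₀ - Kc * (t₀ - ts) + δ) = N * δ := by rw [← he, h]; ring
        rw [this] at hgs; linarith
      · have : N * (-(xs - x₀) - Kc * (t₀ - ts) + δ) = N * δ := by rw [← he, h]; ring
        rw [this] at hgs; linarith
    have : 0 < 2 / κ := by positivity
    linarith
  have hzI := cone_interior x₀ t₀ Kc xs ts hK0 hts hlat'
  obtain ⟨σ, hσ, hmo⟩ := hmonocond _ hzC
  have hdist : ∀ z z' : ℝ × ℝ, dist z z' ≤ |z.1 - z'.1| + |z.2 - z'.2| := by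
    intro z z'
    rw [Prod.dist_eq, Real.dist_eq, Real.dist_eq]
    exact max_le (by linarith [abs_nonneg (z.2 - z'.2)]) (by linarith [abs_nonneg (z.1 - z'.1)])
  obtain ⟨L, hL1, hL⟩ : ∃ L : ℝ, 1 ≤ L ∧ ∀ z ∈ cone x₀ t₀ Kc, ∀ z' ∈ cone x₀ t₀ Kc,
      v₁ z - g z - v₂ z' ≤
      v₁ (xs, ts) - g (xs, ts) - v₂ (xs, ts) + L * (|z.1 - z'.1| + |z.2 - z'.2|) := by
    obtain ⟨Lg, hLg⟩ := LocallyLipschitzOn.exists_lipschitzOnWith_of_compact hC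
      (hg.locallyLipschitz.locallyLipschitzOn (s := cone x₀ t₀ Kc))
    obtain ⟨L, hL⟩ := hlipone
    refine ⟨1 + L + Lg, by linarith [L.2, Lg.2, L.coe_nonneg, Lg.coe_nonneg], fun z hz z' hz' => ?_⟩
    have d := hdist z z'
    have d0 : 0 ≤ dist z z' := dist_nonneg
    have hg1 := hLg.dist_le_mul z hz z' hz'
    rw [Real.dist_eq] at hg1
    have hg2 := (abs_le.1 hg1).1
    have hkey : (L + Lg) * dist z z' ≤ (1 + L + Lg : ℝ) * (|z.1 - z'.1| + |z.2 - z'.2|) := by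
      have := L.coe_nonneg
      have := Lg.coe_nonneg
      apply mul_le_mul _ d d0 (by linarith); linarith
    have hLgd : 0 ≤ (Lg:ℝ) * dist z z' := by positivity
    rcases hL with hL | hL
    · have h1 := hL.dist_le_mul z hz z' hz'
      rw [Real.dist_eq] at h1
      have h2 := (abs_le.1 h1).2
      have := hmaxle z' hz'
      linarith
    · have h1 := hL.dist_le_mul z hz z' hz'
      rw [Real.dist_eq] at h1
      have h2 := (abs_le.1 h1).2
      have := hmaxle z hz
      linarith
  refine core H hHpos hHlip (essUp ct) (essLow ct) (cone x₀ t₀ Kc) hC Kc hK0 ?_ xs ts hzI σ hσ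
    (fun M hM ε hε => mono_of_limsup ct hctpos hloc xs σ M hM (hmo M hM) ε hε)
    v₁ v₂ g hcont1 hcont2 hg ?_ L hL1 hL η hη0 hgd hsub hsuper
  · intro p hp
    exact ⟨essLow_nonneg ct hctpos hloc _, (essLow_le_essUp ct hloc _).trans ((hM' p hp).trans hM'K.le)⟩
  · intro p q hp hq h
    rcases le_total p.1 q.1 with h1 | h1
    · obtain ⟨a, b⟩ := hx2 p q hp hq h h1
      rw [abs_sub_comm, abs_of_nonneg (by linarith), abs_sub_comm, abs_of_nonneg (by linarith)]
      exact b
    · obtain ⟨a, b⟩ := hx2 q p hq hp h.symm h1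
      rw [abs_of_nonneg (by linarith), abs_of_nonneg (by linarith)]
      exact b
end
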